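/- arXiv:2007.12893 — 2 statements merged into one kernel-verified Lean document; each statement's English description precedes it below -/
import Mathlib

section
/- Let P = conv{x_1,…,x_m} ⊂ ℝ^d be a full-dimensional compact convex polytope with facets F_1,…,F_f, each of which is a simplicial polytope, and fix s ≥ 0. Define the surface adjoint α_P^s(t_1,…,t_d,u_1,…,u_f) = ∑_{i=1}^f V_{d−1}(F_i) · Ad_{F_i}(t) · u_i^s · ∏_{k∉F_i} ℒ_k(t), an element of ℝ[u_1,…,u_f][t_1,…,t_d]. Then α_P^s has degree at most m − d as a polynomial in t_1,…,t_d, and for every specialization of u_1,…,u_f to real numbers, the resulting polynomial in t vanishes at every point of the union ⋃_{i=1}^f NF(F_i) of the nonface subspace arrangements of the facets of P. -/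
open MeasureTheory Finset

/-- A triangulation of the facet `conv{x_k : k ∈ F}` of a polytope in Euclidean `ℝ^d`
into `(d−1)`-simplices using only the vertices of the facet: their union is the facet
and their relative interiors are pairwise disjoint. -/
structure FacetTri (d m : ℕ) (x : Fin m → EuclideanSpace ℝ (Fin d)) (F : Finset (Fin m)) where
  simplices : Finset (Finset (Fin m))
  subset : ∀ σ ∈ simplices, σ ⊆ F
  card_eq : ∀ σ ∈ simplices, σ.card = d
  indep : ∀ σ ∈ simplices, AffineIndependent ℝ (fun k : {k // k ∈ σ} => x k.1)
  covers : (⋃ σ ∈ simplices, convexHull ℝ (x '' ↑σ)) = convexHull ℝ (x '' ↑F)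
  disj : ∀ σ ∈ simplices, ∀ τ ∈ simplices, σ ≠ τ →
    intrinsicInterior ℝ (convexHull ℝ (x '' ↑σ)) ∩
      intrinsicInterior ℝ (convexHull ℝ (x '' ↑τ)) = ∅

/-- `(d−1)`-dimensional Hausdorff volume `V_{d−1}(S) = H^{d−1}(S)`. -/
noncomputable def hVol (d : ℕ) (S : Set (EuclideanSpace ℝ (Fin d))) : ℝ :=
  (μH[(d : ℝ) - 1] S).toReal

/-- The affine-linear polynomial `ℒ_k(t) = 1 − x_{k,1}t_1 − ⋯ − x_{k,d}t_d`. -/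
noncomputable def Lpoly (d m : ℕ) (x : Fin m → EuclideanSpace ℝ (Fin d)) (k : Fin m) :
    MvPolynomial (Fin d) ℝ :=
  1 - ∑ j, MvPolynomial.C (x k j) * MvPolynomial.X j

/-- The facet adjoint `Ad_F(t) = ∑_{σ∈Σ_F} (V_{d−1}(σ)/V_{d−1}(F)) ∏_{k∈F∖σ} ℒ_k(t)`. -/
noncomputable def facetAdjoint (d m : ℕ) (x : Fin m → EuclideanSpace ℝ (Fin d))
    (F : Finset (Fin m)) (T : FacetTri d m x F) : MvPolynomial (Fin d) ℝ :=
  ∑ σ ∈ T.simplices,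
    MvPolynomial.C (hVol d (convexHull ℝ (x '' ↑σ)) / hVol d (convexHull ℝ (x '' ↑F))) *
      ∏ k ∈ F \ σ, Lpoly d m x k

/-- The surface adjoint
`α_P^s(t,u) = ∑_{i=1}^f V_{d−1}(F_i)·Ad_{F_i}(t)·u_i^s·∏_{k∉F_i} ℒ_k(t)`,
here with the `u`-variables specialized to the real numbers `uu i`, as a polynomial in
`t_1,…,t_d`. -/
noncomputable def surfaceAdjoint (d m f s : ℕ) (x : Fin m → EuclideanSpace ℝ (Fin d))
    (F : Fin f → Finset (Fin m)) (T : ∀ i, FacetTri d m x (F i)) (uu : Fin f → ℝ) :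
    MvPolynomial (Fin d) ℝ :=
  ∑ i, MvPolynomial.C (hVol d (convexHull ℝ (x '' ↑(F i))) * uu i ^ s) *
    facetAdjoint d m x (F i) (T i) * ∏ k ∈ (F i)ᶜ, Lpoly d m x k

/-- `τ` indexes the vertex set of a face of the facet `conv{x_k : k ∈ F}`. -/
def IsFaceVtxSetOfFacet (d m : ℕ) (x : Fin m → EuclideanSpace ℝ (Fin d))
    (F τ : Finset (Fin m)) : Prop :=
  ∃ G : Set (EuclideanSpace ℝ (Fin d)),
    IsExposed ℝ (convexHull ℝ (x '' ↑F)) G ∧ x '' ↑τ = G ∩ (x '' ↑F)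

/-- The closed simplicial cone spanned by a basis. -/
def closedCone {d : ℕ} (B : Module.Basis (Fin d) ℝ (Fin d → ℝ)) : Set (Fin d → ℝ) :=
  {z | ∀ j, 0 ≤ B.repr z j}

/-- The open simplicial cone spanned by a basis. -/
def openCone {d : ℕ} (B : Module.Basis (Fin d) ℝ (Fin d → ℝ)) : Set (Fin d → ℝ) :=
  {z | ∀ j, 0 < B.repr z j}

/-- The volume of the parallelepiped spanned by a basis. -/
noncomputable def basisVol {d : ℕ} (B : Module.Basis (Fin d) ℝ (Fin d → ℝ)) : ℝ :=
  |LinearMap.det (B.equivFun.symm : (Fin d → ℝ) →ₗ[ℝ] (Fin d → ℝ))|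

lemma basisVol_pos {d : ℕ} (B : Module.Basis (Fin d) ℝ (Fin d → ℝ)) : 0 < basisVol B :=
  abs_pos.2 (LinearEquiv.isUnit_det' B.equivFun.symm).ne_zero

lemma continuous_repr_apply {d : ℕ} (B : Module.Basis (Fin d) ℝ (Fin d → ℝ)) (j : Fin d) :
    Continuous fun z => B.repr z j :=
  LinearMap.continuous_of_finiteDimensional (B.coord j)

lemma isClosed_closedCone {d : ℕ} (B : Module.Basis (Fin d) ℝ (Fin d → ℝ)) :
    IsClosed (closedCone B) := by
  simp only [closedCone, Set.ofPred_forall]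
  exact isClosed_iInter fun j => isClosed_le continuous_const (continuous_repr_apply B j)

lemma volume_closedCone_diff_openCone {d : ℕ} (B : Module.Basis (Fin d) ℝ (Fin d → ℝ)) :
    volume (closedCone B \ openCone B) = 0 := by
  refine measure_mono_null (t := ⋃ j, ((LinearMap.ker (B.coord j) : Submodule ℝ (Fin d → ℝ)) :
    Set (Fin d → ℝ))) ?_ ?_
  · rintro z ⟨hz, hz'⟩
    simp only [openCone, Set.mem_ofPred_eq, not_forall, not_lt] at hz'
    obtain ⟨j, hj⟩ := hz'
    refine Set.mem_iUnion.2 ⟨j, ?_⟩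
    simpa using le_antisymm hj (hz j)
  · refine measure_iUnion_null fun j => Measure.addHaar_submodule _ _ fun h => ?_
    have : B j ∈ LinearMap.ker (B.coord j) := h ▸ Submodule.mem_top
    simp at this

lemma lintegral_closedCone {d : ℕ} (B : Module.Basis (Fin d) ℝ (Fin d → ℝ)) (w : Fin d → ℝ)
    (hw : ∀ j, 0 < w ⬝ᵥ B j) :
    ∫⁻ z in closedCone B, ENNReal.ofReal (Real.exp (-(w ⬝ᵥ z))) =
      ENNReal.ofReal (basisVol B / ∏ j, w ⬝ᵥ B j) := by
  have himage : closedCone B =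
      (LinearMap.toContinuousLinearMap
        (B.equivFun.symm : (Fin d → ℝ) →ₗ[ℝ] (Fin d → ℝ))) '' (Set.univ.pi fun _ => Set.Ici 0) := by
    ext z
    constructor
    · intro hz
      exact ⟨B.equivFun z, fun j _ => hz j, by simp⟩
    · rintro ⟨a, ha, rfl⟩ j
      have := ha j (Set.mem_univ j)
      have h2 : B.repr (B.equivFun.symm a) j = a j :=
        congrFun (B.equivFun.apply_symm_apply a) j
      change 0 ≤ B.repr (B.equivFun.symm a) j
      rwa [h2]
  rw [himage, lintegral_image_eq_lintegral_abs_det_fderiv_mul volume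
    (MeasurableSet.univ_pi fun _ => measurableSet_Ici)
    (fun x _ => (ContinuousLinearMap.hasFDerivWithinAt _))
    (fun a _ b _ h => B.equivFun.symm.injective h)]
  have hexp (a : Fin d → ℝ) : Real.exp (-(w ⬝ᵥ B.equivFun.symm a)) =
      ∏ j, Real.exp (-(w ⬝ᵥ B j) * a j) := by
    rw [← Real.exp_sum]
    congr 1
    rw [Module.Basis.equivFun_symm_apply, dotProduct_sum, ← Finset.sum_neg_distrib]
    refine Finset.sum_congr rfl fun j _ => ?_
    rw [dotProduct_smul, smul_eq_mul]; ring
  have hint (j : Fin d) : Integrable (fun r => Real.exp (-(w ⬝ᵥ B j) * r))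
      (volume.restrict (Set.Ici (0 : ℝ))) := by
    have := integrableOn_exp_mul_Ioi (a := -(w ⬝ᵥ B j)) (by simpa using hw j) 0
    rw [← IntegrableOn, integrableOn_Ici_iff_integrableOn_Ioi]
    exact this
  rw [lintegral_const_mul' _ _ ENNReal.ofReal_ne_top]
  change ENNReal.ofReal (basisVol B) * _ = _
  rw [div_eq_mul_inv, ENNReal.ofReal_mul (basisVol_pos B).le]
  congr 1
  simp only [LinearMap.coe_toContinuousLinearMap', LinearEquiv.coe_coe, hexp]
  rw [volume_pi, Measure.restrict_pi_pi, ← ofReal_integral_eq_lintegral_ofReal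
    (Integrable.fintype_prod hint) (.of_forall fun a => by positivity),
    integral_fintype_prod_eq_prod (fun j r => Real.exp (-(w ⬝ᵥ B j) * r)),
    ← Finset.prod_inv_distrib]
  congr 1
  refine Finset.prod_congr rfl fun j _ => ?_
  rw [integral_Ici_eq_integral_Ioi, integral_exp_mul_Ioi (by simpa using hw j)]
  simp

lemma aedisjoint_closedCone {d : ℕ} {B B' : Module.Basis (Fin d) ℝ (Fin d → ℝ)}
    (h : Disjoint (openCone B) (openCone B')) :
    AEDisjoint volume (closedCone B) (closedCone B') := by
  refine measure_mono_null (t := (closedCone B \ openCone B) ∪ (closedCone B' \ openCone B'))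
    ?_ ?_
  · rintro z ⟨hz, hz'⟩
    by_cases h1 : z ∈ openCone B
    · exact Or.inr ⟨hz', fun h2 => Set.disjoint_left.1 h h1 h2⟩
    · exact Or.inl ⟨hz, h1⟩
  · exact measure_union_null (volume_closedCone_diff_openCone B)
      (volume_closedCone_diff_openCone B')

lemma lintegral_iUnion_closedCone {d : ℕ} {ι : Type*} (s : Finset ι)
    (B : ι → Module.Basis (Fin d) ℝ (Fin d → ℝ))
    (hdisj : ∀ i ∈ s, ∀ i' ∈ s, i ≠ i' → Disjoint (openCone (B i)) (openCone (B i')))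
    (w : Fin d → ℝ) (hw : ∀ i ∈ s, ∀ j, 0 < w ⬝ᵥ B i j) :
    ∫⁻ z in ⋃ i ∈ s, closedCone (B i), ENNReal.ofReal (Real.exp (-(w ⬝ᵥ z))) =
      ENNReal.ofReal (∑ i ∈ s, basisVol (B i) / ∏ j, w ⬝ᵥ B i j) := by
  rw [lintegral_biUnion_finset₀
    (fun i hi i' hi' hne => aedisjoint_closedCone (hdisj i hi i' hi' hne))
    (fun i _ => (isClosed_closedCone (B i)).measurableSet.nullMeasurableSet),
    ENNReal.ofReal_sum_of_nonneg]
  · exact Finset.sum_congr rfl fun i hi => lintegral_closedCone (B i) w (hw i hi)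
  · exact fun i hi => div_nonneg (basisVol_pos _).le
      (Finset.prod_nonneg fun j _ => (hw i hi j).le)

/-- Two families of simplicial cones with disjoint interiors and almost everywhere equal unions,
with generators among the vectors `y k`, `k ∈ F`, have the same adjoint polynomial. -/
lemma adjoint_eq_of_iUnion_ae_eq {d : ℕ} {κ ι ι' : Type} [DecidableEq κ] (y : κ → Fin d → ℝ)
    (F : Finset κ) (u : Fin d → ℝ) (hu : ∀ k ∈ F, u ⬝ᵥ y k = 1)
    (s : Finset ι) (s' : Finset ι')
    (B : ι → Module.Basis (Fin d) ℝ (Fin d → ℝ)) (B' : ι' → Module.Basis (Fin d) ℝ (Fin d → ℝ))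
    (e : ι → Fin d → κ) (e' : ι' → Fin d → κ)
    (heB : ∀ i ∈ s, ∀ j, B i j = y (e i j)) (heB' : ∀ i ∈ s', ∀ j, B' i j = y (e' i j))
    (he : ∀ i ∈ s, ∀ j, e i j ∈ F) (he' : ∀ i ∈ s', ∀ j, e' i j ∈ F)
    (hdisj : ∀ i ∈ s, ∀ i' ∈ s, i ≠ i' → Disjoint (openCone (B i)) (openCone (B i')))
    (hdisj' : ∀ i ∈ s', ∀ i' ∈ s', i ≠ i' → Disjoint (openCone (B' i)) (openCone (B' i')))
    (hae : (⋃ i ∈ s, closedCone (B i)) =ᵐ[volume] (⋃ i ∈ s', closedCone (B' i)))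
    (w : Fin d → ℝ) :
    ∑ i ∈ s, basisVol (B i) * ∏ k ∈ F \ univ.image (e i), w ⬝ᵥ y k =
      ∑ i ∈ s', basisVol (B' i) * ∏ k ∈ F \ univ.image (e' i), w ⬝ᵥ y k := by
  have hanal {α : Type} (t : Finset α) (b : α → ℝ) (f : α → Finset κ) :
      AnalyticOnNhd ℝ (fun w : Fin d → ℝ => ∑ i ∈ t, b i * ∏ k ∈ f i, w ⬝ᵥ y k) Set.univ := by
    intro z _
    refine Finset.analyticAt_fun_sum _ fun i _ => analyticAt_const.mul ?_
    refine Finset.analyticAt_fun_prod _ fun k _ => ?_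
    unfold dotProduct
    refine Finset.analyticAt_fun_sum _ fun j _ => AnalyticAt.mul ?_ analyticAt_const
    exact (ContinuousLinearMap.proj (R := ℝ) (φ := fun _ : Fin d => ℝ) j).analyticAt z
  have key {α : Type} (t : Finset α) (C : α → Module.Basis (Fin d) ℝ (Fin d → ℝ))
      (g : α → Fin d → κ) (hgC : ∀ i ∈ t, ∀ j, C i j = y (g i j))
      (hg : ∀ i ∈ t, ∀ j, g i j ∈ F) (w : Fin d → ℝ) (hw : ∀ k ∈ F, 0 < w ⬝ᵥ y k) :
      ∑ i ∈ t, basisVol (C i) * ∏ k ∈ F \ univ.image (g i), w ⬝ᵥ y k =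
        (∏ k ∈ F, w ⬝ᵥ y k) * ∑ i ∈ t, basisVol (C i) / ∏ j, w ⬝ᵥ C i j := by
    rw [Finset.mul_sum]
    refine Finset.sum_congr rfl fun i hi => ?_
    have hinj : Function.Injective (g i) := fun a b hab => (C i).injective (by
      rw [hgC i hi, hgC i hi, hab])
    have hsub : univ.image (g i) ⊆ F := by
      intro k hk
      obtain ⟨j, -, rfl⟩ := Finset.mem_image.1 hk
      exact hg i hi j
    have h1 : ∏ j, w ⬝ᵥ C i j = ∏ k ∈ univ.image (g i), w ⬝ᵥ y k := by
      rw [Finset.prod_image hinj.injOn]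
      exact Finset.prod_congr rfl fun j _ => by rw [hgC i hi]
    have h2 : ∏ k ∈ univ.image (g i), w ⬝ᵥ y k ≠ 0 :=
      (Finset.prod_pos fun k hk => hw k (hsub hk)).ne'
    rw [h1, ← Finset.prod_sdiff hsub]
    field_simp
  refine congrFun (AnalyticOnNhd.eq_of_eventuallyEq (z₀ := u)
    (hanal s (fun i => basisVol (B i)) fun i => F \ univ.image (e i))
    (hanal s' (fun i => basisVol (B' i)) fun i => F \ univ.image (e' i)) ?_) w
  have hpos : ∀ᶠ w in nhds u, ∀ k ∈ F, 0 < w ⬝ᵥ y k := by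
    rw [Filter.eventually_all_finset]
    intro k hk
    have hc : Continuous fun w : Fin d → ℝ => w ⬝ᵥ y k := by fun_prop
    exact hc.continuousAt.eventually (lt_mem_nhds (by simp [hu k hk]))
  filter_upwards [hpos] with w hw
  rw [key s B e heB he w hw, key s' B' e' heB' he' w hw]
  congr 1
  have h1 := lintegral_iUnion_closedCone s B hdisj w fun i hi j => by
    rw [heB i hi]; exact hw _ (he i hi j)
  have h2 := lintegral_iUnion_closedCone s' B' hdisj' w fun i hi j => by
    rw [heB' i hi]; exact hw _ (he' i hi j)
  rw [setLIntegral_congr hae, h2] at h1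
  refine ((ENNReal.ofReal_eq_ofReal_iff ?_ ?_).1 h1).symm
  · exact Finset.sum_nonneg fun i hi => div_nonneg (basisVol_pos _).le
      (Finset.prod_nonneg fun j _ => by rw [heB' i hi]; exact (hw _ (he' i hi j)).le)
  · exact Finset.sum_nonneg fun i hi => div_nonneg (basisVol_pos _).le
      (Finset.prod_nonneg fun j _ => by rw [heB i hi]; exact (hw _ (he i hi j)).le)

lemma exists_basis_update {d : ℕ} (B : Module.Basis (Fin d) ℝ (Fin d → ℝ)) (j : Fin d)
    (x : Fin d → ℝ) (hx : B.repr x j ≠ 0) :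
    ∃ C : Module.Basis (Fin d) ℝ (Fin d → ℝ), ⇑C = Function.update B j x := by
  have hli : LinearIndependent ℝ (Function.update B j x) := by
    rw [Fintype.linearIndependent_iff]
    intro g hg
    have hsum : g j • x + ∑ i ∈ univ.erase j, g i • B i = 0 := by
      rw [← hg, ← Finset.add_sum_erase _ _ (mem_univ j), Function.update_self]
      congr 1
      refine Finset.sum_congr rfl fun i hi => ?_
      rw [Function.update_of_ne (Finset.ne_of_mem_erase hi)]
    have hj : g j = 0 := by
      have h1 := congrArg (B.coord j) hsum
      simp only [map_add, map_sum, map_smul, map_zero, Module.Basis.coord_apply,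
        Module.Basis.repr_self, smul_eq_mul] at h1
      rw [Finset.sum_eq_zero, add_zero] at h1
      · exact (mul_eq_zero.1 h1).resolve_right hx
      · intro i hi
        rw [Finsupp.single_eq_of_ne (Finset.ne_of_mem_erase hi).symm, mul_zero]
    intro i
    by_cases hij : i = j
    · rw [hij, hj]
    · have h1 := congrArg (B.coord i) hsum
      rw [hj, zero_smul, zero_add] at h1
      simp only [map_sum, map_smul, map_zero, Module.Basis.coord_apply,
        Module.Basis.repr_self, smul_eq_mul] at h1
      rw [Finset.sum_eq_single_of_mem i (by simp [hij])] at h1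
      · simpa using h1
      · intro l _ hl
        rw [Finsupp.single_eq_of_ne hl.symm, mul_zero]
  exact ⟨basisOfLinearIndependentOfCardEqFinrank' _ hli (by simp), by simp⟩

lemma eventually_forall_pos {d : ℕ} (a c : Fin d → ℝ)
    (h : ∀ j, 0 < a j ∨ 0 ≤ a j ∧ 0 < c j) :
    ∀ᶠ ε in nhdsWithin (0 : ℝ) (Set.Ioi 0), ∀ j, 0 < a j + ε * c j := by
  rw [Filter.eventually_all]
  intro j
  rcases h j with h | ⟨h, h'⟩
  · have hc : ContinuousAt (fun ε : ℝ => a j + ε * c j) 0 := by fun_prop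
    exact (hc.eventually (lt_mem_nhds (by simpa using h))).filter_mono nhdsWithin_le_nhds
  · filter_upwards [self_mem_nhdsWithin] with ε hε
    exact add_pos_of_nonneg_of_pos h (mul_pos hε h')

lemma eventually_forall_nonneg {d : ℕ} (a c : Fin d → ℝ)
    (h : ∀ j, 0 < a j ∨ 0 ≤ a j ∧ 0 ≤ c j) :
    ∀ᶠ ε in nhdsWithin (0 : ℝ) (Set.Ioi 0), ∀ j, 0 ≤ a j + ε * c j := by
  rw [Filter.eventually_all]
  intro j
  rcases h j with h | ⟨h, h'⟩
  · have hc : ContinuousAt (fun ε : ℝ => a j + ε * c j) 0 := by fun_prop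
    filter_upwards [(hc.eventually (lt_mem_nhds (by simpa using h))).filter_mono
      nhdsWithin_le_nhds] with ε hε using hε.le
  · filter_upwards [self_mem_nhdsWithin] with ε hε
    exact add_nonneg h (mul_nonneg (le_of_lt hε) h')

/-- `φ` is nonnegative on the vectors `y k`, `k ∈ F`, positive at `y v`, and vanishes on the facet
of the simplicial cone of `B` opposite to the `j`-th generator. -/
def SupportsFacet {d : ℕ} {κ : Type} (y : κ → Fin d → ℝ) (F : Finset κ) (v : κ)
    (B : Module.Basis (Fin d) ℝ (Fin d → ℝ)) (j : Fin d)
    (φ : (Fin d → ℝ) →ₗ[ℝ] ℝ) : Prop :=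
  (∀ k ∈ F, 0 ≤ φ (y k)) ∧ (∀ l, l ≠ j → φ (B l) = 0) ∧ 0 < φ (y v)

lemma SupportsFacet.apply_eq {d : ℕ} {κ : Type} {y : κ → Fin d → ℝ} {F : Finset κ} {v : κ}
    {B : Module.Basis (Fin d) ℝ (Fin d → ℝ)} {j : Fin d} {φ : (Fin d → ℝ) →ₗ[ℝ] ℝ}
    (h : SupportsFacet y F v B j φ) (z : Fin d → ℝ) : φ z = B.repr z j * φ (B j) := by
  conv_lhs => rw [← B.sum_repr z]
  rw [map_sum, Finset.sum_eq_single j]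
  · simp
  · intro l _ hl
    simp [h.2.1 l hl]
  · simp

lemma SupportsFacet.repr_ne_zero {d : ℕ} {κ : Type} {y : κ → Fin d → ℝ} {F : Finset κ} {v : κ}
    {B : Module.Basis (Fin d) ℝ (Fin d → ℝ)} {j : Fin d} {φ : (Fin d → ℝ) →ₗ[ℝ] ℝ}
    (h : SupportsFacet y F v B j φ) : B.repr (y v) j ≠ 0 := by
  intro h0
  have h1 := h.2.2
  rw [h.apply_eq, h0, zero_mul] at h1
  exact lt_irrefl _ h1

/-- A point of the open cone over the facet of `B` opposite to `B j` with apex `x`. -/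
lemma exists_of_mem_openCone_update {d : ℕ} {B C : Module.Basis (Fin d) ℝ (Fin d → ℝ)}
    {j : Fin d} {x z : Fin d → ℝ} (hC : ⇑C = Function.update B j x) (hz : z ∈ openCone C) :
    ∃ a : ℝ, 0 < a ∧ B.repr (z - a • x) j = 0 ∧ ∀ l, l ≠ j → 0 < B.repr (z - a • x) l := by
  refine ⟨C.repr z j, hz j, ?_⟩
  have hsum : z - C.repr z j • x = ∑ i ∈ univ.erase j, C.repr z i • B i := by
    conv_lhs => enter [1]; rw [← C.sum_repr z]
    rw [← Finset.add_sum_erase _ _ (mem_univ j), hC, Function.update_self, add_sub_cancel_left]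
    refine Finset.sum_congr rfl fun i hi => ?_
    rw [Function.update_of_ne (Finset.ne_of_mem_erase hi)]
  have hrepr (l : Fin d) : B.repr (z - C.repr z j • x) l = if l = j then 0 else C.repr z l := by
    rw [hsum, map_sum, Finsupp.finsetSum_apply]
    simp only [map_smul, Module.Basis.repr_self, Finsupp.smul_apply, smul_eq_mul,
      Finsupp.single_apply, mul_ite, mul_one, mul_zero]
    rw [Finset.sum_ite_eq']
    by_cases hl : l = j <;> simp [hl]
  refine ⟨by rw [hrepr, if_pos rfl], fun l hl => ?_⟩
  rw [hrepr, if_neg hl]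
  exact hz l

/-- Cones with apex `y v` over different boundary facets have disjoint interiors. -/
lemma disjoint_openCone_pulled {d : ℕ} {κ ι : Type} {y : κ → Fin d → ℝ} {F : Finset κ} {v : κ}
    {B : ι → Module.Basis (Fin d) ℝ (Fin d → ℝ)}
    (hB : ∀ i l, ∃ k ∈ F, B i l = y k)
    (hdisj : ∀ i i', i ≠ i' → Disjoint (openCone (B i)) (openCone (B i')))
    {q q' : ι × Fin d} {φ φ' : (Fin d → ℝ) →ₗ[ℝ] ℝ}
    (hφ : SupportsFacet y F v (B q.1) q.2 φ) (hφ' : SupportsFacet y F v (B q'.1) q'.2 φ')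
    {C C' : Module.Basis (Fin d) ℝ (Fin d → ℝ)}
    (hC : ⇑C = Function.update (B q.1) q.2 (y v)) (hC' : ⇑C' = Function.update (B q'.1) q'.2 (y v))
    (hne : q ≠ q') : Disjoint (openCone C) (openCone C') := by
  rw [Set.disjoint_left]
  intro z hz hz'
  obtain ⟨a, -, hp0, hp⟩ := exists_of_mem_openCone_update hC hz
  obtain ⟨a', -, hp0', hp'⟩ := exists_of_mem_openCone_update hC' hz'
  -- a functional nonnegative on `F` is nonnegative at points with nonnegative coordinates
  have hnonneg (ψ : (Fin d → ℝ) →ₗ[ℝ] ℝ) (hψ : ∀ k ∈ F, 0 ≤ ψ (y k)) (i : ι) (j : Fin d)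
      (x : Fin d → ℝ) (h0 : (B i).repr x j = 0) (h : ∀ l, l ≠ j → 0 < (B i).repr x l) :
      0 ≤ ψ x := by
    rw [← (B i).sum_repr x, map_sum]
    refine Finset.sum_nonneg fun l _ => ?_
    rw [map_smul, smul_eq_mul]
    refine mul_nonneg ?_ ?_
    · by_cases hl : l = j
      · rw [hl, h0]
      · exact (h l hl).le
    · obtain ⟨k, hk, hBk⟩ := hB i l
      rw [hBk]; exact hψ k hk
  have h1 : φ (z - a • y v) = 0 := by rw [hφ.apply_eq, hp0, zero_mul]
  have h1' : φ' (z - a' • y v) = 0 := by rw [hφ'.apply_eq, hp0', zero_mul]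
  have h2 := hnonneg φ hφ.1 q'.1 q'.2 _ hp0' hp'
  have h2' := hnonneg φ' hφ'.1 q.1 q.2 _ hp0 hp
  simp only [map_sub, map_smul, smul_eq_mul] at h1 h1' h2 h2'
  have haa : a = a' := by
    refine le_antisymm ?_ ?_
    · exact le_of_mul_le_mul_right (by linarith) hφ'.2.2
    · exact le_of_mul_le_mul_right (by linarith) hφ.2.2
  subst haa
  set p := z - a • y v with hpdef
  -- `φ` also vanishes on the second facet
  have hφB : φ p = 0 := by rw [hφ.apply_eq, hp0, zero_mul]
  have hzero : ∀ l, l ≠ q'.2 → φ (B q'.1 l) = 0 := by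
    rw [← (B q'.1).sum_repr p, map_sum, Finset.sum_eq_zero_iff_of_nonneg] at hφB
    · intro l hl
      have := hφB l (mem_univ l)
      rw [map_smul, smul_eq_mul] at this
      exact (mul_eq_zero.1 this).resolve_left (hp' l hl).ne'
    · intro l _
      obtain ⟨k, hk, hBk⟩ := hB q'.1 l
      rw [map_smul, smul_eq_mul]
      refine mul_nonneg ?_ (hBk ▸ hφ.1 k hk)
      by_cases hl : l = q'.2
      · rw [hl, hp0']
      · exact (hp' l hl).le
  have hφ2 : SupportsFacet y F v (B q'.1) q'.2 φ := ⟨hφ.1, hzero, hφ.2.2⟩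
  have hpos : 0 < φ (B q.1 q.2) := by
    obtain ⟨k, hk, hBk⟩ := hB q.1 q.2
    refine lt_of_le_of_ne (hBk ▸ hφ.1 k hk) fun h => ?_
    have := hφ.2.2
    rw [hφ.apply_eq, ← h, mul_zero] at this
    exact lt_irrefl _ this
  have hcoord : 0 < (B q'.1).repr (B q.1 q.2) q'.2 := by
    have h3 := hφ2.apply_eq (B q.1 q.2)
    obtain ⟨k, hk, hBk⟩ := hB q'.1 q'.2
    have h4 : 0 ≤ φ (B q'.1 q'.2) := hBk ▸ hφ.1 k hk
    by_contra hcon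
    have := mul_nonpos_of_nonpos_of_nonneg (not_lt.1 hcon) h4
    linarith
  have hi : q.1 = q'.1 := by
    by_contra hi
    have hev := eventually_forall_pos (fun l => (B q'.1).repr p l)
      (fun l => (B q'.1).repr (B q.1 q.2) l) fun l => by
        by_cases hl : l = q'.2
        · exact Or.inr (by rw [hl]; exact ⟨hp0'.ge, hcoord⟩)
        · exact Or.inl (hp' l hl)
    have hev' := eventually_forall_pos (fun l => (B q.1).repr p l)
      (fun l => (B q.1).repr (B q.1 q.2) l) fun l => by
        by_cases hl : l = q.2
        · exact Or.inr (by rw [hl]; exact ⟨hp0.ge, by simp⟩)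
        · exact Or.inl (hp l hl)
    obtain ⟨ε, hε, hε'⟩ := (hev.and hev').exists
    have hm : p + ε • B q.1 q.2 ∈ openCone (B q.1) := fun l => by
      simpa only [map_add, map_smul, Finsupp.add_apply, Finsupp.smul_apply, smul_eq_mul]
        using hε' l
    have hm' : p + ε • B q.1 q.2 ∈ openCone (B q'.1) := fun l => by simpa using hε l
    exact Set.disjoint_left.1 (hdisj _ _ hi) hm hm'
  refine hne (Prod.ext hi ?_)
  by_contra hj
  rw [← hi] at hzero
  exact hpos.ne' (hzero _ hj)

/-- The union of a family of simplicial cones covering a pointed cone is that pointed cone. -/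
lemma closedCone_subset_hull {d : ℕ} {κ : Type} {y : κ → Fin d → ℝ} {F : Finset κ}
    {B : Module.Basis (Fin d) ℝ (Fin d → ℝ)} (hB : ∀ l, ∃ k ∈ F, B l = y k) :
    closedCone B ⊆ (PointedCone.hull ℝ (y '' F) : Set (Fin d → ℝ)) := by
  intro z hz
  rw [← B.sum_repr z]
  refine Submodule.sum_mem _ fun l _ => PointedCone.smul_mem _ (hz l) ?_
  obtain ⟨k, hk, hBk⟩ := hB l
  rw [hBk]
  exact PointedCone.subset_hull ⟨k, hk, rfl⟩

/-- Apart from a null set, every point of a polyhedral cone lies in the join of the ray through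
`y v` with a boundary facet of one of the simplicial cones covering it. -/
lemma exists_supportsFacet {d : ℕ} {κ ι : Type} [Finite ι] {y : κ → Fin d → ℝ} {F : Finset κ}
    {v : κ} (hv : v ∈ F) (u : Fin d → ℝ) (hu : ∀ k ∈ F, u ⬝ᵥ y k = 1)
    {B : ι → Module.Basis (Fin d) ℝ (Fin d → ℝ)}
    (hB : ∀ i l, ∃ k ∈ F, B i l = y k)
    (hcov : (PointedCone.hull ℝ (y '' F) : Set (Fin d → ℝ)) ⊆ ⋃ i, closedCone (B i)) :
    ∀ᵐ z, z ∈ PointedCone.hull ℝ (y '' F) → ∃ i j φ, SupportsFacet y F v (B i) j φ ∧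
      ∃ s : ℝ, 0 ≤ s ∧ (B i).repr (z - s • y v) j = 0 ∧ z - s • y v ∈ closedCone (B i) := by
  set K := PointedCone.hull ℝ (y '' F) with hK
  have hKeq : (K : Set (Fin d → ℝ)) = ⋃ i, closedCone (B i) :=
    hcov.antisymm (Set.iUnion_subset fun i => closedCone_subset_hull (hB i))
  have hKclosed : IsClosed (K : Set (Fin d → ℝ)) := by
    rw [hKeq]
    exact isClosed_iUnion_of_finite fun i => isClosed_closedCone (B i)
  have hyK (k : κ) (hk : k ∈ F) : y k ∈ K := PointedCone.subset_hull ⟨k, hk, rfl⟩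
  have huK (z : Fin d → ℝ) (hz : z ∈ K) : 0 ≤ u ⬝ᵥ z := by
    induction hz using Submodule.span_induction with
    | mem x hx => obtain ⟨k, hk, rfl⟩ := hx; rw [hu k hk]; exact zero_le_one
    | zero => simp
    | add x x' _ _ h h' => rw [dotProduct_add]; exact add_nonneg h h'
    | smul r x _ h =>
      change 0 ≤ u ⬝ᵥ ((r : ℝ) • x)
      rw [dotProduct_smul]; exact mul_nonneg r.2 h
  -- the exceptional set
  have hgen : ∀ᵐ z, ∀ i j j', j ≠ j' → z ∉ Submodule.span ℝ
      (((insert (y v) ((univ.filter fun l => l ≠ j ∧ l ≠ j').image (B i)) :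
        Finset (Fin d → ℝ)) : Set (Fin d → ℝ))) := by
    rw [ae_all_iff]; intro i
    rw [ae_all_iff]; intro j
    rw [ae_all_iff]; intro j'
    by_cases hj : j = j'
    · simp [hj]
    · have h0 := Measure.addHaar_submodule (volume : Measure (Fin d → ℝ)) (Submodule.span ℝ
        (((insert (y v) ((univ.filter fun l => l ≠ j ∧ l ≠ j').image (B i)) :
          Finset (Fin d → ℝ)) : Set (Fin d → ℝ)))) (by
        intro htop
        have h1 := finrank_span_finset_le_card (R := ℝ)
          (insert (y v) ((univ.filter fun l => l ≠ j ∧ l ≠ j').image (B i)))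
        rw [Set.finrank, htop, finrank_top, Module.finrank_fin_fun] at h1
        have h2 : (univ.filter fun l => l ≠ j ∧ l ≠ j') = ({j, j'} : Finset (Fin d))ᶜ := by
          ext l; simp
        have h3 := (Finset.card_insert_le (y v)
          ((univ.filter fun l => l ≠ j ∧ l ≠ j').image (B i))).trans
          (Nat.add_le_add_right Finset.card_image_le 1)
        have h4 := Finset.card_add_card_compl ({j, j'} : Finset (Fin d))
        rw [Finset.card_pair hj, Fintype.card_fin] at h4
        rw [h2] at h3 h1
        omega)
      filter_upwards [measure_eq_zero_iff_ae_notMem.1 h0] with z hz _ using hz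
  filter_upwards [hgen] with z hz hzK
  -- travel from `z` in the direction `-y v` until leaving the cone
  set S : Set ℝ := {s | 0 ≤ s ∧ z - s • y v ∈ K} with hS
  have hSclosed : IsClosed S :=
    (isClosed_le continuous_const continuous_id).inter (hKclosed.preimage
      (f := fun s : ℝ => z - s • y v) (by fun_prop))
  have hSbdd : S ⊆ Set.Icc 0 (u ⬝ᵥ z) := by
    rintro s ⟨hs, hs'⟩
    have := huK _ hs'
    rw [dotProduct_sub, dotProduct_smul, hu v hv, smul_eq_mul, mul_one] at this
    exact ⟨hs, by linarith⟩
  have hScomp : IsCompact S := isCompact_Icc.of_isClosed_subset hSclosed hSbdd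
  obtain ⟨s, ⟨hs0, hsK⟩, hsmax⟩ := hScomp.exists_isGreatest ⟨0, le_rfl, by simpa using hzK⟩
  set p := z - s • y v with hp
  have hout (ε : ℝ) (hε : 0 < ε) : p - ε • y v ∉ K := by
    intro h
    have : s + ε ∈ S := ⟨by linarith, by
      have : z - (s + ε) • y v = p - ε • y v := by rw [hp, add_smul]; abel
      rwa [this]⟩
    linarith [hsmax this]
  obtain ⟨i, hpi⟩ := Set.mem_iUnion.1 (hcov hsK)
  have hexit : ∃ j, (B i).repr p j = 0 ∧ 0 < (B i).repr (y v) j := by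
    by_contra! hcon
    obtain ⟨ε, hε, hε0⟩ := ((eventually_forall_nonneg (fun l => (B i).repr p l)
      (fun l => -(B i).repr (y v) l) fun l => by
        by_cases hl : (B i).repr p l = 0
        · exact Or.inr ⟨hl.ge, neg_nonneg.2 (hcon l hl)⟩
        · exact Or.inl (lt_of_le_of_ne (hpi l) (Ne.symm hl))).and self_mem_nhdsWithin).exists
    refine hout ε hε0 (closedCone_subset_hull (hB i) fun l => ?_)
    have := hε l
    simp only [map_sub, map_smul, Finsupp.sub_apply, Finsupp.smul_apply, smul_eq_mul]
    linarith
  obtain ⟨j, hj0, hjv⟩ := hexit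
  have huniq (l : Fin d) (hl : l ≠ j) : 0 < (B i).repr p l := by
    refine lt_of_le_of_ne (hpi l) fun hl0 => hz i j l hl.symm ?_
    have hzp : z = p + s • y v := by rw [hp]; abel
    rw [hzp]
    refine Submodule.add_mem _ ?_ (Submodule.smul_mem _ _ (Submodule.subset_span (by simp)))
    rw [← (B i).sum_repr p]
    refine Submodule.sum_mem _ fun l' _ => ?_
    by_cases h1 : l' = j
    · rw [h1, hj0, zero_smul]; exact Submodule.zero_mem _
    by_cases h2 : l' = l
    · rw [h2, ← hl0, zero_smul]; exact Submodule.zero_mem _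
    refine Submodule.smul_mem _ _ (Submodule.subset_span ?_)
    rw [Finset.coe_insert, Finset.coe_image]
    exact Or.inr ⟨l', by simp [h1, h2], rfl⟩
  refine ⟨i, j, (B i).coord j, ⟨fun k hk => ?_, fun l hl => ?_, by simpa using hjv⟩,
    s, hs0, hj0, hpi⟩
  · rw [Module.Basis.coord_apply]
    by_contra! hneg
    set γ := (B i).repr (y v) j
    set β := (B i).repr (y k) j
    set r := - y v - (γ / -β) • y k with hr
    have hr0 : (B i).repr r j = 0 := by
      simp only [hr, map_sub, map_neg, map_smul, Finsupp.sub_apply, Finsupp.neg_apply,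
        Finsupp.smul_apply, smul_eq_mul]
      change -γ - γ / -β * β = 0
      field_simp [hneg.ne]
      ring
    obtain ⟨ε, hε, hε0⟩ := ((eventually_forall_nonneg (fun l => (B i).repr p l)
      (fun l => (B i).repr r l) fun l => by
        by_cases hl : l = j
        · exact Or.inr (by rw [hl]; exact ⟨hj0.ge, hr0.ge⟩)
        · exact Or.inl (huniq l hl)).and self_mem_nhdsWithin).exists
    refine hout ε hε0 ?_
    have hmem : p + ε • r ∈ K :=
      closedCone_subset_hull (hB i) fun l => by simpa using hε l
    have heq : p - ε • y v = (p + ε • r) + (ε * (γ / -β)) • y k := by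
      rw [hr, smul_sub, smul_neg, smul_smul]; abel
    rw [heq]
    refine K.add_mem hmem (PointedCone.smul_mem _ ?_ (hyK k hk))
    exact mul_nonneg (le_of_lt hε0) (div_nonneg hjv.le (by linarith))
  · rw [Module.Basis.coord_apply, Module.Basis.repr_self, Finsupp.single_eq_of_ne hl.symm]

/-- If every functional nonnegative on `y k`, `k ∈ F`, and vanishing on `y k`, `k ∈ τ`, vanishes
on `y v` for some `v ∈ F \ τ`, then the adjoint vanishes where all `y k`, `k ∈ τ`, do. -/
theorem adjoint_eq_zero {d : ℕ} {κ ι : Type} [DecidableEq κ] [Fintype ι] {y : κ → Fin d → ℝ}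
    {F : Finset κ} {v : κ} (hv : v ∈ F) (u : Fin d → ℝ) (hu : ∀ k ∈ F, u ⬝ᵥ y k = 1)
    {B : ι → Module.Basis (Fin d) ℝ (Fin d → ℝ)} (e : ι → Fin d → κ)
    (heB : ∀ i l, B i l = y (e i l)) (heF : ∀ i l, e i l ∈ F)
    (hdisj : ∀ i i', i ≠ i' → Disjoint (openCone (B i)) (openCone (B i')))
    (hcov : (PointedCone.hull ℝ (y '' F) : Set (Fin d → ℝ)) ⊆ ⋃ i, closedCone (B i))
    {τ : Finset κ} (hτF : τ ⊆ F) (hvτ : v ∉ τ)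
    (hface : ∀ φ : (Fin d → ℝ) →ₗ[ℝ] ℝ, (∀ k ∈ F, 0 ≤ φ (y k)) → (∀ k ∈ τ, φ (y k) = 0) →
      φ (y v) = 0)
    (w : Fin d → ℝ) (hw : ∀ k ∈ τ, w ⬝ᵥ y k = 0) :
    ∑ i, basisVol (B i) * ∏ k ∈ F \ univ.image (e i), w ⬝ᵥ y k = 0 := by
  classical
  have hB (i : ι) (l : Fin d) : ∃ k ∈ F, B i l = y k := ⟨e i l, heF i l, heB i l⟩
  set Q : Finset (ι × Fin d) := univ.filter fun q => ∃ φ, SupportsFacet y F v (B q.1) q.2 φ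
    with hQ
  have hexC (q : ι × Fin d) : ∃ C : Module.Basis (Fin d) ℝ (Fin d → ℝ),
      q ∈ Q → ⇑C = Function.update (B q.1) q.2 (y v) := by
    by_cases hq : q ∈ Q
    · obtain ⟨φ, hφ⟩ := (Finset.mem_filter.1 hq).2
      obtain ⟨C, hC⟩ := exists_basis_update (B q.1) q.2 (y v) hφ.repr_ne_zero
      exact ⟨C, fun _ => hC⟩
    · exact ⟨B q.1, fun h => absurd h hq⟩
  choose C hC using hexC
  have heC (q : ι × Fin d) (hq : q ∈ Q) (l : Fin d) :
      C q l = y (Function.update (e q.1) q.2 v l) := by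
    rw [hC q hq]
    by_cases hl : l = q.2
    · rw [hl, Function.update_self, Function.update_self]
    · rw [Function.update_of_ne hl, Function.update_of_ne hl, heB]
  have heCF (q : ι × Fin d) (l : Fin d) : Function.update (e q.1) q.2 v l ∈ F := by
    by_cases hl : l = q.2
    · rw [hl, Function.update_self]; exact hv
    · rw [Function.update_of_ne hl]; exact heF _ _
  have hae : (⋃ i ∈ (univ : Finset ι), closedCone (B i)) =ᵐ[volume]
      (⋃ q ∈ Q, closedCone (C q)) := by
    refine Filter.eventuallyLE_antisymm_iff.2 ⟨?_, ?_⟩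
    · filter_upwards [exists_supportsFacet hv u hu hB hcov] with z hz hzU
      simp only [mem_univ, Set.iUnion_true] at hzU
      obtain ⟨i₀, hi₀⟩ := Set.mem_iUnion.1 hzU
      obtain ⟨i, j, φ, hφ, s, hs, hj, hp⟩ := hz (closedCone_subset_hull (hB i₀) hi₀)
      have hq : (i, j) ∈ Q := Finset.mem_filter.2 ⟨mem_univ _, φ, hφ⟩
      refine Set.mem_iUnion₂.2 ⟨(i, j), hq, ?_⟩
      have hzC : z = s • C (i, j) j + ∑ l ∈ univ.erase j,
          (B i).repr (z - s • y v) l • C (i, j) l := by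
        have h1 := (B i).sum_repr (z - s • y v)
        rw [← Finset.add_sum_erase _ _ (mem_univ j), hj, zero_smul, zero_add] at h1
        rw [hC _ hq, Function.update_self]
        rw [eq_sub_iff_add_eq, add_comm] at h1
        conv_lhs => rw [← h1]
        congr 1
        refine Finset.sum_congr rfl fun l hl => ?_
        rw [Function.update_of_ne (Finset.ne_of_mem_erase hl)]
      intro l
      rw [hzC, map_add, map_sum, Finsupp.add_apply, Finsupp.finsetSum_apply]
      refine add_nonneg ?_ (Finset.sum_nonneg fun l' _ => ?_)
      · rw [map_smul, Module.Basis.repr_self, Finsupp.smul_apply, Finsupp.single_apply]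
        split_ifs <;> simp [hs]
      · rw [map_smul, Module.Basis.repr_self, Finsupp.smul_apply, Finsupp.single_apply]
        have := hp l'
        split_ifs <;> simp only [smul_eq_mul, mul_one, mul_zero, le_refl, this]
    · refine Filter.Eventually.of_forall fun z hz => ?_
      obtain ⟨q, hq, hz⟩ := Set.mem_iUnion₂.1 hz
      simp only [mem_univ, Set.iUnion_true]
      refine hcov (closedCone_subset_hull (fun l => ?_) hz)
      exact ⟨_, heCF q l, heC q hq l⟩
  rw [adjoint_eq_of_iUnion_ae_eq y F u hu univ Q B C e
    (fun q => Function.update (e q.1) q.2 v) (fun i _ => heB i) heC (fun i _ => heF i)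
    (fun q _ => heCF q) (fun i _ i' _ => hdisj i i') ?_ hae w]
  · refine Finset.sum_eq_zero fun q hq => ?_
    obtain ⟨φ, hφ⟩ := (Finset.mem_filter.1 hq).2
    have hex : ∃ k ∈ τ, k ∉ univ.image (Function.update (e q.1) q.2 v) := by
      by_contra! hcon
      refine hφ.2.2.ne' (hface φ hφ.1 fun k hk => ?_)
      obtain ⟨l, -, hl⟩ := Finset.mem_image.1 (hcon k hk)
      by_cases hlj : l = q.2
      · rw [hlj, Function.update_self] at hl
        exact absurd (hl ▸ hk) hvτ
      · rw [Function.update_of_ne hlj] at hl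
        rw [← hl, ← heB]
        exact hφ.2.1 l hlj
    obtain ⟨k, hk, hk'⟩ := hex
    rw [Finset.prod_eq_zero (Finset.mem_sdiff.2 ⟨hτF hk, hk'⟩) (hw k hk), mul_zero]
  · intro q hq q' hq' hne
    obtain ⟨φ, hφ⟩ := (Finset.mem_filter.1 hq).2
    obtain ⟨φ', hφ'⟩ := (Finset.mem_filter.1 hq').2
    exact disjoint_openCone_pulled hB hdisj hφ hφ' (hC q hq) (hC q' hq') hne

/-- A linear map preserving the inner product with a unit vector `u` scales the codimension one
Hausdorff measure of subsets of the hyperplane `⟪u, z⟫ = 1` by its determinant. -/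
lemma hVol_image_linearMap {d : ℕ} {u : EuclideanSpace ℝ (Fin d)} (hu : ‖u‖ = 1)
    (G : EuclideanSpace ℝ (Fin d) →ₗ[ℝ] EuclideanSpace ℝ (Fin d))
    (hG : ∀ z, inner ℝ u (G z) = inner ℝ u z) {S : Set (EuclideanSpace ℝ (Fin d))}
    (hS : ∀ z ∈ S, inner ℝ u z = 1) : hVol d (G '' S) = |LinearMap.det G| * hVol d S := by
  have hu0 : u ≠ 0 := by rintro rfl; simp at hu
  obtain ⟨n, rfl⟩ : ∃ n, d = n + 1 := by
    cases d with
    | zero => exact absurd (Subsingleton.elim u 0) hu0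
    | succ n => exact ⟨n, rfl⟩
  have : Fact (Module.finrank ℝ (EuclideanSpace ℝ (Fin (n + 1))) = n + 1) :=
    ⟨finrank_euclideanSpace_fin⟩
  rcases S.eq_empty_or_nonempty with rfl | ⟨p, hp⟩
  · simp [hVol]
  set W : Submodule ℝ (EuclideanSpace ℝ (Fin (n + 1))) := (ℝ ∙ u)ᗮ with hW
  have hrank : Module.finrank ℝ W = n := Submodule.finrank_orthogonal_span_singleton hu0
  have hmemW (z : EuclideanSpace ℝ (Fin (n + 1))) : z ∈ W ↔ inner ℝ u z = 0 :=
    Submodule.mem_orthogonal_singleton_iff_inner_right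
  have hGW : W ≤ W.comap G := fun z hz => by
    rw [Submodule.mem_comap, hmemW, hG]; exact (hmemW z).1 hz
  have hdet : LinearMap.det G = LinearMap.det (G.restrict hGW) := by
    rw [LinearMap.det_eq_det_mul_det W G hGW]
    have : W.mapQ W G hGW = LinearMap.id := by
      refine Submodule.linearMap_qext _ (LinearMap.ext fun z => ?_)
      change W.mkQ (G z) = W.mkQ z
      rw [← sub_eq_zero, ← map_sub, Submodule.mkQ_apply, Submodule.Quotient.mk_eq_zero, hmemW,
        inner_sub_right, hG, sub_self]
    rw [this, LinearMap.det_id, mul_one]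
  set K : Set W := {z | p + (z : EuclideanSpace ℝ (Fin (n + 1))) ∈ S} with hK
  have hSK : S = (fun z : W => p + (z : EuclideanSpace ℝ (Fin (n + 1)))) '' K := by
    ext z
    constructor
    · intro hz
      refine ⟨⟨z - p, ?_⟩, ?_, ?_⟩
      · rw [hmemW, inner_sub_right, hS z hz, hS p hp, sub_self]
      · simpa [hK] using hz
      · simp
    · rintro ⟨z, hz, rfl⟩
      exact hz
  have hGSK : G '' S = (fun z : W => G p + (z : EuclideanSpace ℝ (Fin (n + 1)))) ''
      (G.restrict hGW '' K) := by
    conv_lhs => rw [hSK]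
    rw [Set.image_image, Set.image_image]
    refine Set.image_congr fun z _ => ?_
    rw [map_add]; rfl
  have hiso (q : EuclideanSpace ℝ (Fin (n + 1))) :
      Isometry (fun z : W => q + (z : EuclideanSpace ℝ (Fin (n + 1)))) :=
    (isometry_add_left q).comp isometry_subtype_coe
  have hdim : (((n + 1 : ℕ) : ℝ) - 1) = (Module.finrank ℝ W : ℝ) := by rw [hrank]; push_cast; ring
  have h0 : (0 : ℝ) ≤ ((n + 1 : ℕ) : ℝ) - 1 := by rw [hdim]; positivity
  unfold hVol
  rw [hGSK, (hiso _).hausdorffMeasure_image (Or.inl h0)]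
  conv_rhs => rw [hSK, (hiso _).hausdorffMeasure_image (Or.inl h0)]
  rw [hdim, Measure.addHaar_image_linearMap, ENNReal.toReal_mul,
    ENNReal.toReal_ofReal (abs_nonneg _), hdet]

/-- `B` is the basis consisting of the points `g j` of the hyperplane `⟪u, z⟫ = 1 - ⟪u, a⟫`
translated by `a`. -/
structure IsLift {d : ℕ} (u a : EuclideanSpace ℝ (Fin d)) (g : Fin d → EuclideanSpace ℝ (Fin d))
    (B : Module.Basis (Fin d) ℝ (Fin d → ℝ)) : Prop where
  eq_add : ∀ j, B j = (g j + a).ofLp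
  dot_eq_one : ∀ j, u.ofLp ⬝ᵥ B j = 1

section IsLift

variable {d : ℕ} {u a : EuclideanSpace ℝ (Fin d)} {g g' : Fin d → EuclideanSpace ℝ (Fin d)}
  {B B' : Module.Basis (Fin d) ℝ (Fin d → ℝ)}

lemma IsLift.dot_eq_sum (h : IsLift u a g B) (z : Fin d → ℝ) :
    u.ofLp ⬝ᵥ z = ∑ j, B.repr z j := by
  conv_lhs => rw [← B.sum_repr z, dotProduct_sum]
  simp [dotProduct_smul, h.dot_eq_one]

lemma IsLift.hVol_mul_basisVol (hu : ‖u‖ = 1) (h : IsLift u a g B) (h' : IsLift u a g' B') :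
    hVol d (convexHull ℝ (Set.range g')) * basisVol B =
      hVol d (convexHull ℝ (Set.range g)) * basisVol B' := by
  have htrans (f : Fin d → EuclideanSpace ℝ (Fin d)) :
      hVol d (convexHull ℝ (Set.range fun j => f j + a)) = hVol d (convexHull ℝ (Set.range f)) := by
    have h1 : convexHull ℝ (Set.range fun j => f j + a) =
        (IsometryEquiv.addRight a) '' convexHull ℝ (Set.range f) := by
      have h2 := AffineMap.image_convexHull
        ((AffineEquiv.vaddConst ℝ a : EuclideanSpace ℝ (Fin d) ≃ᵃ[ℝ] _) :
          EuclideanSpace ℝ (Fin d) →ᵃ[ℝ] EuclideanSpace ℝ (Fin d)) (Set.range f)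
      rw [← Set.range_comp] at h2
      exact h2.symm
    unfold hVol
    rw [h1, IsometryEquiv.hausdorffMeasure_image]
  set G₀ : (Fin d → ℝ) →ₗ[ℝ] (Fin d → ℝ) :=
    (B'.equivFun.symm : (Fin d → ℝ) →ₗ[ℝ] (Fin d → ℝ)) ∘ₗ
      (B.equivFun : (Fin d → ℝ) →ₗ[ℝ] (Fin d → ℝ)) with hG₀
  set E := (WithLp.linearEquiv 2 ℝ (Fin d → ℝ)).symm with hE
  set G : EuclideanSpace ℝ (Fin d) →ₗ[ℝ] EuclideanSpace ℝ (Fin d) :=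
    (E : (Fin d → ℝ) →ₗ[ℝ] EuclideanSpace ℝ (Fin d)) ∘ₗ G₀ ∘ₗ
      (E.symm : EuclideanSpace ℝ (Fin d) →ₗ[ℝ] (Fin d → ℝ)) with hG
  have hG₀B (j : Fin d) : G₀ (B j) = B' j := by
    change B'.equivFun.symm (B.equivFun (B j)) = _
    rw [B'.equivFun_symm_apply, Finset.sum_eq_single j]
    · simp
    · intro i _ hi
      simp [hi.symm]
    · simp
  have hGg (j : Fin d) : G (g j + a) = g' j + a := by
    change WithLp.toLp 2 (G₀ (g j + a).ofLp) = _
    rw [← h.eq_add, hG₀B, h'.eq_add]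
  have hinner (z z' : EuclideanSpace ℝ (Fin d)) : inner ℝ z z' = z.ofLp ⬝ᵥ z'.ofLp := by
    rw [EuclideanSpace.inner_eq_star_dotProduct, dotProduct_comm]; simp
  have hGu (z : EuclideanSpace ℝ (Fin d)) : inner ℝ u (G z) = inner ℝ u z := by
    rw [hinner, hinner]
    change u.ofLp ⬝ᵥ G₀ z.ofLp = _
    conv_lhs => rw [← B.sum_repr z.ofLp, map_sum, dotProduct_sum]
    rw [h.dot_eq_sum]
    simp [hG₀B, dotProduct_smul, h'.dot_eq_one]
  have hdet : |LinearMap.det G| * basisVol B = basisVol B' := by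
    rw [hG, LinearMap.det_conj, hG₀, LinearMap.det_comp, basisVol, basisVol, abs_mul, mul_assoc,
      ← abs_mul, LinearEquiv.det_mul_det_symm, abs_one, mul_one]
  have himage : convexHull ℝ (Set.range fun j => g' j + a) =
      G '' convexHull ℝ (Set.range fun j => g j + a) := by
    rw [LinearMap.image_convexHull, ← Set.range_comp]
    congr 2
    funext j
    exact (hGg j).symm
  have hplane : ∀ z ∈ convexHull ℝ (Set.range fun j => g j + a), inner ℝ u z = 1 := by
    intro z hz
    refine convexHull_min (t := {z | inner ℝ u z = 1}) ?_ ?_ hz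
    · rintro _ ⟨j, rfl⟩
      change inner ℝ u (g j + a) = 1
      rw [hinner, ← h.eq_add, h.dot_eq_one]
    · exact convex_hyperplane (innerₛₗ ℝ u).isLinear 1
  rw [← htrans g', ← htrans g, himage, hVol_image_linearMap hu G hGu hplane, ← hdet]
  ring

lemma IsLift.mem_convexHull (h : IsLift u a g B) {z : EuclideanSpace ℝ (Fin d)}
    (hz : u.ofLp ⬝ᵥ (z + a).ofLp = 1) (hzB : (z + a).ofLp ∈ closedCone B) :
    z ∈ convexHull ℝ (Set.range g) := by
  have hsum : ∑ j, B.repr (z + a).ofLp j = 1 := by rw [← h.dot_eq_sum, hz]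
  refine mem_convexHull_of_exists_fintype (B.repr (z + a).ofLp) g hzB hsum
    (fun j => ⟨j, rfl⟩) ?_
  have h1 := B.sum_repr (z + a).ofLp
  simp only [h.eq_add] at h1
  have h2 : ∑ j, B.repr (z + a).ofLp j • (g j + a) = z + a := by
    apply (WithLp.linearEquiv 2 ℝ (Fin d → ℝ)).injective
    rw [map_sum]
    simp only [map_smul]
    exact h1
  simp only [smul_add, Finset.sum_add_distrib, ← Finset.sum_smul, hsum, one_smul] at h2
  exact add_right_cancel h2

lemma IsLift.mem_closedCone (h : IsLift u a g B) {z : EuclideanSpace ℝ (Fin d)}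
    (hz : z ∈ convexHull ℝ (Set.range g)) : (z + a).ofLp ∈ closedCone B := by
  refine convexHull_min (t := {z | (z + a).ofLp ∈ closedCone B}) ?_ ?_ hz
  · rintro _ ⟨j, rfl⟩ l
    rw [← h.eq_add, Module.Basis.repr_self, Finsupp.single_apply]
    split_ifs <;> norm_num
  · intro p hp q hq α β hα hβ hαβ l
    have h1 : (α • p + β • q + a).ofLp = α • (p + a).ofLp + β • (q + a).ofLp := by
      conv_lhs => rw [← one_smul ℝ a, ← hαβ]
      ext i
      simp only [PiLp.add_apply, PiLp.smul_apply, Pi.add_apply, Pi.smul_apply, smul_eq_mul]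
      ring
    rw [h1, map_add, map_smul, map_smul]
    exact add_nonneg (mul_nonneg hα (hp l)) (mul_nonneg hβ (hq l))

lemma IsLift.mem_intrinsicInterior (h : IsLift u a g B) {z : EuclideanSpace ℝ (Fin d)}
    (hz : u.ofLp ⬝ᵥ (z + a).ofLp = 1) (hzB : (z + a).ofLp ∈ openCone B) :
    z ∈ intrinsicInterior ℝ (convexHull ℝ (Set.range g)) := by
  have hzc : z ∈ convexHull ℝ (Set.range g) := h.mem_convexHull hz fun j => (hzB j).le
  rw [_root_.mem_intrinsicInterior]
  refine ⟨⟨z, subset_affineSpan ℝ _ hzc⟩, mem_interior.2 ⟨Subtype.val ⁻¹'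
    {z' : EuclideanSpace ℝ (Fin d) | (z' + a).ofLp ∈ openCone B}, ?_, ?_, hzB⟩, rfl⟩
  · rintro ⟨z', hz'⟩ hz'B
    refine h.mem_convexHull ?_ fun j => (hz'B j).le
    rw [affineSpan_convexHull] at hz'
    refine affineSpan_induction (p := fun z' => u.ofLp ⬝ᵥ (z' + a).ofLp = 1) hz' ?_ ?_
    · rintro _ ⟨j, rfl⟩
      rw [← h.eq_add, h.dot_eq_one]
    · intro α p q r hp hq hr
      simp only [WithLp.ofLp_add, dotProduct_add] at hp hq hr
      simp only [vsub_eq_sub, vadd_eq_add, WithLp.ofLp_add, WithLp.ofLp_smul, WithLp.ofLp_sub,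
        dotProduct_add, dotProduct_smul, dotProduct_sub, smul_eq_mul]
      linear_combination α * hp - α * hq + hr
  · refine IsOpen.preimage continuous_subtype_val ?_
    have : {z' : EuclideanSpace ℝ (Fin d) | (z' + a).ofLp ∈ openCone B} =
        ⋂ j, {z' | 0 < B.repr (z' + a).ofLp j} := by
      ext; simp [openCone]
    rw [this]
    refine isOpen_iInter_of_finite fun j => isOpen_lt continuous_const ?_
    exact (continuous_repr_apply B j).comp
      ((PiLp.continuous_ofLp 2 _).comp (continuous_id.add continuous_const))

end IsLift

lemma exists_isLift {d : ℕ} {u a : EuclideanSpace ℝ (Fin d)} {g : Fin d → EuclideanSpace ℝ (Fin d)}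
    (hg : AffineIndependent ℝ g) (h : ∀ j, u.ofLp ⬝ᵥ (g j + a).ofLp = 1) :
    ∃ B, IsLift u a g B := by
  have hli : LinearIndependent ℝ fun j => (g j + a).ofLp := by
    rw [Fintype.linearIndependent_iff]
    intro w hw
    have hw0 : ∑ j, w j = 0 := by
      have h1 := congrArg (fun z => u.ofLp ⬝ᵥ z) hw
      simpa only [dotProduct_sum, dotProduct_smul, h, smul_eq_mul, mul_one, dotProduct_zero]
        using h1
    have hw1 : ∑ j, w j • (g j + a) = 0 := by
      apply (WithLp.linearEquiv 2 ℝ (Fin d → ℝ)).injective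
      rw [map_sum, map_zero]
      simp only [map_smul]
      exact hw
    simp only [smul_add, Finset.sum_add_distrib, ← Finset.sum_smul, hw0, zero_smul, add_zero]
      at hw1
    exact fun j => affineIndependent_iff.1 hg univ w hw0 hw1 j (mem_univ j)
  refine ⟨basisOfLinearIndependentOfCardEqFinrank' _ hli (by simp), fun j => by simp, fun j => ?_⟩
  rw [coe_basisOfLinearIndependentOfCardEqFinrank', h]

lemma smul_mem_openCone {d : ℕ} {B : Module.Basis (Fin d) ℝ (Fin d → ℝ)} {r : ℝ} (hr : 0 < r)
    {z : Fin d → ℝ} (hz : z ∈ openCone B) : r • z ∈ openCone B := fun j => by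
  rw [map_smul]
  exact mul_pos hr (hz j)

lemma smul_mem_closedCone {d : ℕ} {B : Module.Basis (Fin d) ℝ (Fin d → ℝ)} {r : ℝ} (hr : 0 ≤ r)
    {z : Fin d → ℝ} (hz : z ∈ closedCone B) : r • z ∈ closedCone B := fun j => by
  rw [map_smul]
  exact mul_nonneg hr (hz j)

lemma IsLift.disjoint_openCone {d : ℕ} {u a : EuclideanSpace ℝ (Fin d)}
    {g g' : Fin d → EuclideanSpace ℝ (Fin d)} {B B' : Module.Basis (Fin d) ℝ (Fin d → ℝ)}
    (hu : ‖u‖ = 1) (h : IsLift u a g B) (h' : IsLift u a g' B')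
    (hdisj : intrinsicInterior ℝ (convexHull ℝ (Set.range g)) ∩
      intrinsicInterior ℝ (convexHull ℝ (Set.range g')) = ∅) :
    Disjoint (openCone B) (openCone B') := by
  rw [Set.disjoint_left]
  intro z hz hz'
  have hne : (univ : Finset (Fin d)).Nonempty := by
    by_contra hne
    rw [univ_nonempty_iff, not_nonempty_iff] at hne
    rw [Subsingleton.elim u 0, norm_zero] at hu
    exact zero_ne_one hu
  have hpos : 0 < u.ofLp ⬝ᵥ z := by
    rw [h.dot_eq_sum]
    exact Finset.sum_pos (fun j _ => hz j) hne
  set q : EuclideanSpace ℝ (Fin d) := WithLp.toLp 2 ((u.ofLp ⬝ᵥ z)⁻¹ • z) - a with hq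
  have hqa : (q + a).ofLp = (u.ofLp ⬝ᵥ z)⁻¹ • z := by rw [hq, sub_add_cancel]
  have hq1 : u.ofLp ⬝ᵥ (q + a).ofLp = 1 := by
    rw [hqa, dotProduct_smul, smul_eq_mul, inv_mul_cancel₀ hpos.ne']
  refine Set.eq_empty_iff_forall_notMem.1 hdisj q
    ⟨h.mem_intrinsicInterior hq1 ?_, h'.mem_intrinsicInterior hq1 ?_⟩
  · rw [hqa]; exact smul_mem_openCone (inv_pos.2 hpos) hz
  · rw [hqa]; exact smul_mem_openCone (inv_pos.2 hpos) hz'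

/-- The cone over a translate of a convex hull consists of the multiples of its points. -/
lemma exists_smul_of_mem_hull {d : ℕ} {κ : Type} (x : κ → EuclideanSpace ℝ (Fin d))
    (a : EuclideanSpace ℝ (Fin d)) (F : Set κ) {z : Fin d → ℝ}
    (hz : z ∈ (PointedCone.hull ℝ ((fun k => (x k + a).ofLp) '' F))) :
    z = 0 ∨ ∃ r : ℝ, 0 < r ∧ ∃ p ∈ convexHull ℝ (x '' F), z = r • (p + a).ofLp := by
  induction hz using Submodule.span_induction with
  | mem z hz =>
    obtain ⟨k, hk, rfl⟩ := hz
    exact Or.inr ⟨1, one_pos, x k, subset_convexHull ℝ _ ⟨k, hk, rfl⟩, (one_smul _ _).symm⟩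
  | zero => exact Or.inl rfl
  | add z z' _ _ hz hz' =>
    rcases hz with rfl | ⟨r, hr, p, hp, rfl⟩
    · rwa [zero_add]
    rcases hz' with rfl | ⟨r', hr', p', hp', rfl⟩
    · rw [add_zero]; exact Or.inr ⟨r, hr, p, hp, rfl⟩
    refine Or.inr ⟨r + r', add_pos hr hr', (r / (r + r')) • p + (r' / (r + r')) • p',
      (convex_convexHull ℝ _) hp hp' (by positivity) (by positivity) ?_, ?_⟩
    · field_simp
    · ext i
      simp only [PiLp.add_apply, PiLp.smul_apply, Pi.add_apply, Pi.smul_apply, smul_eq_mul]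
      field_simp
      ring
  | smul r z _ hz =>
    obtain ⟨r, hr⟩ := r
    rcases hz with rfl | ⟨r', hr', p, hp, rfl⟩
    · exact Or.inl (smul_zero _)
    rcases hr.eq_or_lt with rfl | hr
    · exact Or.inl (zero_smul ℝ (r' • (p + a).ofLp))
    · exact Or.inr ⟨r * r', mul_pos hr hr', p, hp, smul_smul r r' (p + a).ofLp⟩

/-- Some linear functional attains its maximum over the points `x k`, `k ∈ F`, exactly at the
points `x k` with `k ∈ τ`. -/
def CutsOut {d m : ℕ} (x : Fin m → EuclideanSpace ℝ (Fin d)) (F τ : Finset (Fin m)) : Prop :=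
  ∃ (l : EuclideanSpace ℝ (Fin d) →ₗ[ℝ] ℝ) (b : ℝ),
    ∀ k ∈ F, l (x k) ≤ b ∧ (l (x k) = b ↔ k ∈ τ)

lemma CutsOut.mono {d m : ℕ} {x : Fin m → EuclideanSpace ℝ (Fin d)} {F F' τ : Finset (Fin m)}
    (h : CutsOut x F τ) (hF : F' ⊆ F) : CutsOut x F' τ := by
  obtain ⟨l, b, h⟩ := h
  exact ⟨l, b, fun k hk => h k (hF hk)⟩

lemma CutsOut.isFaceVtxSetOfFacet {d m : ℕ} {x : Fin m → EuclideanSpace ℝ (Fin d)}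
    {F τ : Finset (Fin m)} (h : CutsOut x F τ) (hτ : τ ⊆ F) : IsFaceVtxSetOfFacet d m x F τ := by
  obtain ⟨l, b, h⟩ := h
  have hle : ∀ z ∈ convexHull ℝ (x '' (F : Set (Fin m))), l z ≤ b := fun z hz =>
    convexHull_min (t := {z | l z ≤ b}) (by rintro _ ⟨k, hk, rfl⟩; exact (h k hk).1)
      (convex_halfSpace_le l.isLinear b) hz
  refine ⟨{z | z ∈ convexHull ℝ (x '' (F : Set (Fin m))) ∧ l z = b}, ?_, ?_⟩
  · rintro ⟨z₀, hz₀, hz₀b⟩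
    refine ⟨LinearMap.toContinuousLinearMap l, Set.ext fun z => ⟨?_, ?_⟩⟩
    · rintro ⟨hz, hzb⟩
      exact ⟨hz, fun y hy => (hle y hy).trans hzb.ge⟩
    · rintro ⟨hz, hzb⟩
      exact ⟨hz, (hle z hz).antisymm (hz₀b.ge.trans (hzb z₀ hz₀))⟩
  · ext z
    constructor
    · rintro ⟨k, hk, rfl⟩
      have hkF : x k ∈ x '' (F : Set (Fin m)) := ⟨k, hτ hk, rfl⟩
      exact ⟨⟨subset_convexHull ℝ _ hkF, (h k (hτ hk)).2.2 hk⟩, hkF⟩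
    · rintro ⟨⟨_, hb⟩, k, hk, rfl⟩
      exact ⟨k, (h k hk).2.1 hb, rfl⟩

/-- A face of a facet of a polytope is a face of the polytope. -/
lemma CutsOut.univ {d m : ℕ} {x : Fin m → EuclideanSpace ℝ (Fin d)} {F τ : Finset (Fin m)}
    (h : CutsOut x F τ) (hτ : τ ⊆ F) (u : EuclideanSpace ℝ (Fin d) →ₗ[ℝ] ℝ) (c : ℝ)
    (hmem : ∀ k ∈ F, u (x k) = c) (hlt : ∀ k ∉ F, u (x k) < c) : CutsOut x univ τ := by
  obtain ⟨l, b, h⟩ := h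
  obtain ⟨N, hN⟩ : ∃ N : ℝ, ∀ k ∉ F, l (x k) - b < N * (c - u (x k)) := by
    obtain ⟨N, hN⟩ := (Set.finite_range fun k => (l (x k) - b) / (c - u (x k))).bddAbove
    refine ⟨N + 1, fun k hk => ?_⟩
    rw [← div_lt_iff₀ (sub_pos.2 (hlt k hk))]
    exact (hN ⟨k, rfl⟩).trans_lt (lt_add_one N)
  refine ⟨l + N • u, b + N * c, fun k _ => ?_⟩
  simp only [LinearMap.add_apply, LinearMap.smul_apply, smul_eq_mul]
  by_cases hk : k ∈ F
  · obtain ⟨h1, h2⟩ := h k hk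
    rw [hmem k hk, add_le_add_iff_right, add_left_inj]
    exact ⟨h1, h2⟩
  · have h1 := hN k hk
    have h2 : l (x k) + N * u (x k) < b + N * c := by linarith
    exact ⟨h2.le, fun h => absurd h h2.ne, fun h => absurd (hτ h) hk⟩

/-- If `τ` is not cut out, then some `v ∉ τ` has the property that every functional that is
nonnegative on the translated points and vanishes at those of `τ` also vanishes at that of `v`. -/
lemma exists_of_not_cutsOut {d m : ℕ} {x : Fin m → EuclideanSpace ℝ (Fin d)}
    {F τ : Finset (Fin m)} (h : ¬ CutsOut x F τ) (a : EuclideanSpace ℝ (Fin d)) :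
    ∃ v ∈ F, v ∉ τ ∧ ∀ φ : (Fin d → ℝ) →ₗ[ℝ] ℝ, (∀ k ∈ F, 0 ≤ φ (x k + a).ofLp) →
      (∀ k ∈ F, k ∈ τ → φ (x k + a).ofLp = 0) → φ (x v + a).ofLp = 0 := by
  by_contra! hcon
  apply h
  choose! φ hφ0 hφτ hφv using hcon
  have hadd (ψ : (Fin d → ℝ) →ₗ[ℝ] ℝ) (k : Fin m) :
      ψ (x k + a).ofLp = ψ (x k).ofLp + ψ a.ofLp := by
    rw [WithLp.ofLp_add, map_add]
  set ψ : (Fin d → ℝ) →ₗ[ℝ] ℝ := ∑ v ∈ F \ τ, φ v with hψ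
  have hval (k : Fin m) : ψ (x k + a).ofLp = ∑ v ∈ F \ τ, φ v (x k + a).ofLp := by
    rw [hψ, LinearMap.sum_apply]
  have hnn : ∀ k ∈ F, ∀ v ∈ F \ τ, 0 ≤ φ v (x k + a).ofLp := fun k hk v hv =>
    hφ0 v (mem_sdiff.1 hv).1 (mem_sdiff.1 hv).2 k hk
  refine ⟨-(ψ ∘ₗ (WithLp.linearEquiv 2 ℝ (Fin d → ℝ)).toLinearMap), ψ a.ofLp, fun k hk => ?_⟩
  have hl : (-(ψ ∘ₗ (WithLp.linearEquiv 2 ℝ (Fin d → ℝ)).toLinearMap)) (x k) =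
      ψ a.ofLp - ψ (x k + a).ofLp := by
    rw [hadd]
    change -(ψ (x k).ofLp) = _
    ring
  have h0 : 0 ≤ ψ (x k + a).ofLp := by rw [hval]; exact Finset.sum_nonneg (hnn k hk)
  rw [hl, sub_le_self_iff, sub_eq_self]
  refine ⟨h0, fun hz => ?_, fun hkτ => ?_⟩
  · by_contra hkτ
    rw [hval, Finset.sum_eq_zero_iff_of_nonneg (hnn k hk)] at hz
    exact hφv k hk hkτ (hz k (mem_sdiff.2 ⟨hk, hkτ⟩))
  · rw [hval]
    exact Finset.sum_eq_zero fun v hv => hφτ v (mem_sdiff.1 hv).1 (mem_sdiff.1 hv).2 k hk hkτ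

lemma eval_Lpoly {d m : ℕ} (x : Fin m → EuclideanSpace ℝ (Fin d)) (k : Fin m) (t : Fin d → ℝ) :
    MvPolynomial.eval t (Lpoly d m x k) = 1 - ∑ j, x k j * t j := by
  simp [Lpoly]

lemma FacetTri.exists_enumeration {d m : ℕ} {x : Fin m → EuclideanSpace ℝ (Fin d)}
    {F : Finset (Fin m)} (T : FacetTri d m x F) :
    ∃ e : {σ // σ ∈ T.simplices} → Fin d → Fin m,
      (∀ σ, univ.image (e σ) = σ.1) ∧ ∀ σ, AffineIndependent ℝ fun j => x (e σ j) := by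
  refine ⟨fun σ => σ.1.orderEmbOfFin (T.card_eq σ.1 σ.2),
    fun σ => Finset.image_orderEmbOfFin_univ _ _, fun σ => ?_⟩
  exact (T.indep σ.1 σ.2).comp_embedding (σ.1.orderIsoOfFin (T.card_eq σ.1 σ.2)).toEmbedding

/-- The facet adjoint vanishes on the subspaces attached to nonfaces of the facet. -/
theorem eval_facetAdjoint_eq_zero {d m : ℕ} {x : Fin m → EuclideanSpace ℝ (Fin d)}
    {F τ : Finset (Fin m)} (T : FacetTri d m x F) {u : EuclideanSpace ℝ (Fin d)} {c : ℝ}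
    (hu : ‖u‖ = 1) (hmem : ∀ k ∈ F, ∑ j, x k j * u j = c) (hτ : τ ⊆ F) (h : ¬ CutsOut x F τ)
    {t : Fin d → ℝ} (ht : ∀ k ∈ τ, 1 - ∑ j, x k j * t j = 0) :
    MvPolynomial.eval t (facetAdjoint d m x F T) = 0 := by
  set a : EuclideanSpace ℝ (Fin d) := (1 - c) • u with ha
  have huu : u.ofLp ⬝ᵥ u.ofLp = 1 := by
    have h1 := EuclideanSpace.real_norm_sq_eq u
    rw [hu, one_pow] at h1
    rw [h1, dotProduct]
    exact Finset.sum_congr rfl fun j _ => (sq _).symm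
  have hdot : ∀ k ∈ F, u.ofLp ⬝ᵥ (x k).ofLp = c := fun k hk => by
    rw [dotProduct_comm]; exact hmem k hk
  have huy : ∀ k ∈ F, u.ofLp ⬝ᵥ (x k + a).ofLp = 1 := fun k hk => by
    rw [ha, WithLp.ofLp_add, WithLp.ofLp_smul, dotProduct_add, dotProduct_smul, hdot k hk, huu,
      smul_eq_mul]
    ring
  set w : Fin d → ℝ := -t + (1 + (1 - c) * (t ⬝ᵥ u.ofLp)) • u.ofLp with hw
  have hwL : ∀ k ∈ F, 1 - ∑ j, x k j * t j = w ⬝ᵥ (x k + a).ofLp := fun k hk => by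
    have h1 : ∑ j, x k j * t j = t ⬝ᵥ (x k).ofLp := by rw [dotProduct_comm]; rfl
    rw [h1, hw, add_dotProduct, smul_dotProduct, huy k hk, neg_dotProduct, ha, WithLp.ofLp_add,
      WithLp.ofLp_smul, dotProduct_add, dotProduct_smul, smul_eq_mul, smul_eq_mul]
    ring
  obtain ⟨e, himage, hind⟩ := T.exists_enumeration
  have heF (σ : {σ // σ ∈ T.simplices}) (j : Fin d) : e σ j ∈ F :=
    T.subset σ.1 σ.2 (himage σ ▸ mem_image_of_mem _ (mem_univ j))
  have hrange (σ : {σ // σ ∈ T.simplices}) :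
      Set.range (fun j => x (e σ j)) = x '' (σ.1 : Set (Fin m)) := by
    rw [← himage σ, coe_image, coe_univ, Set.image_univ, ← Set.range_comp]; rfl
  have hB (σ : {σ // σ ∈ T.simplices}) : ∃ B, IsLift u a (fun j => x (e σ j)) B :=
    exists_isLift (hind σ) fun j => huy _ (heF σ j)
  choose B hB using hB
  obtain ⟨v, hvF, hvτ, hv⟩ := exists_of_not_cutsOut h a
  rcases T.simplices.eq_empty_or_nonempty with hT | ⟨σ₀, hσ₀⟩
  · simp [facetAdjoint, hT]
  have hcov : (PointedCone.hull ℝ ((fun k => (x k + a).ofLp) '' (F : Set (Fin m))) :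
      Set (Fin d → ℝ)) ⊆ ⋃ σ, closedCone (B σ) := by
    intro z hz
    rcases exists_smul_of_mem_hull x a _ hz with rfl | ⟨r, hr, p, hp, rfl⟩
    · exact Set.mem_iUnion.2 ⟨⟨σ₀, hσ₀⟩, fun j => by simp⟩
    · rw [← T.covers] at hp
      obtain ⟨σ, hσ, hp⟩ := Set.mem_iUnion₂.1 hp
      refine Set.mem_iUnion.2 ⟨⟨σ, hσ⟩, smul_mem_closedCone hr.le ((hB ⟨σ, hσ⟩).mem_closedCone ?_)⟩
      rwa [hrange]
  have hsum := adjoint_eq_zero (y := fun k => (x k + a).ofLp) hvF u.ofLp huy e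
    (fun σ j => (hB σ).eq_add j) heF
    (fun σ σ' hne => (hB σ).disjoint_openCone hu (hB σ') (by
      rw [hrange, hrange]
      exact T.disj σ.1 σ.2 σ'.1 σ'.2 fun h => hne (Subtype.ext h)))
    hcov hτ hvτ (fun φ h0 h1 => hv φ h0 fun k _ hk => h1 k hk) w
    (fun k hk => by rw [← hwL k (hτ hk), ht k hk])
  have hvol (σ : {σ // σ ∈ T.simplices}) : hVol d (convexHull ℝ (x '' (σ.1 : Set (Fin m)))) =
      hVol d (convexHull ℝ (x '' (σ₀ : Set (Fin m)))) / basisVol (B ⟨σ₀, hσ₀⟩) *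
        basisVol (B σ) := by
    have h1 := (hB ⟨σ₀, hσ₀⟩).hVol_mul_basisVol hu (hB σ)
    rw [hrange, hrange] at h1
    rw [div_mul_eq_mul_div, ← h1, mul_div_assoc, div_self (basisVol_pos _).ne', mul_one]
  rw [facetAdjoint, map_sum, ← Finset.sum_coe_sort]
  calc ∑ σ : {σ // σ ∈ T.simplices}, MvPolynomial.eval t
        (MvPolynomial.C (hVol d (convexHull ℝ (x '' (σ.1 : Set (Fin m)))) /
          hVol d (convexHull ℝ (x '' (F : Set (Fin m))))) * ∏ k ∈ F \ σ.1, Lpoly d m x k)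
      = ∑ σ : {σ // σ ∈ T.simplices}, hVol d (convexHull ℝ (x '' (σ₀ : Set (Fin m)))) /
          basisVol (B ⟨σ₀, hσ₀⟩) / hVol d (convexHull ℝ (x '' (F : Set (Fin m)))) *
          (basisVol (B σ) * ∏ k ∈ F \ univ.image (e σ), w ⬝ᵥ (x k + a).ofLp) := by
        refine Finset.sum_congr rfl fun σ _ => ?_
        rw [map_mul, MvPolynomial.eval_C, map_prod, himage, hvol σ,
          Finset.prod_congr rfl fun k hk =>
            (eval_Lpoly x k t).trans (hwL k (mem_sdiff.1 hk).1)]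
        ring
    _ = 0 := by rw [← Finset.mul_sum, hsum, mul_zero]

lemma totalDegree_Lpoly_le {d m : ℕ} (x : Fin m → EuclideanSpace ℝ (Fin d)) (k : Fin m) :
    (Lpoly d m x k).totalDegree ≤ 1 := by
  refine (MvPolynomial.totalDegree_sub _ _).trans (max_le (by simp) ?_)
  refine MvPolynomial.totalDegree_finsetSum_le fun j _ => ?_
  refine (MvPolynomial.totalDegree_mul _ _).trans ?_
  simp

lemma totalDegree_prod_Lpoly_le {d m : ℕ} (x : Fin m → EuclideanSpace ℝ (Fin d))
    (A : Finset (Fin m)) : (∏ k ∈ A, Lpoly d m x k).totalDegree ≤ A.card := by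
  refine (MvPolynomial.totalDegree_finsetProd _ _).trans ?_
  simpa using Finset.sum_le_sum fun k (_ : k ∈ A) => totalDegree_Lpoly_le x k

lemma totalDegree_facetAdjoint_le {d m : ℕ} (x : Fin m → EuclideanSpace ℝ (Fin d))
    (F : Finset (Fin m)) (T : FacetTri d m x F) :
    (facetAdjoint d m x F T).totalDegree ≤ F.card - d := by
  refine MvPolynomial.totalDegree_finsetSum_le fun σ hσ => ?_
  refine (MvPolynomial.totalDegree_mul _ _).trans ?_
  rw [MvPolynomial.totalDegree_C, zero_add]
  refine (totalDegree_prod_Lpoly_le x _).trans ?_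
  rw [card_sdiff_of_subset (T.subset σ hσ), T.card_eq σ hσ]

lemma totalDegree_surfaceAdjoint_le {d m f s : ℕ} (x : Fin m → EuclideanSpace ℝ (Fin d))
    (F : Fin f → Finset (Fin m)) (T : ∀ i, FacetTri d m x (F i)) (uu : Fin f → ℝ) :
    (surfaceAdjoint d m f s x F T uu).totalDegree ≤ m - d := by
  refine MvPolynomial.totalDegree_finsetSum_le fun i _ => ?_
  rcases (T i).simplices.eq_empty_or_nonempty with hT | ⟨σ, hσ⟩
  · simp [facetAdjoint, hT]
  have hd : d ≤ (F i).card := (T i).card_eq σ hσ ▸ card_le_card ((T i).subset σ hσ)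
  have hcard : (F i).card ≤ m := by simpa using card_le_univ (F i)
  have h1 := totalDegree_facetAdjoint_le x (F i) (T i)
  have h2 := totalDegree_prod_Lpoly_le x (F i)ᶜ
  rw [card_compl, Fintype.card_fin] at h2
  refine (MvPolynomial.totalDegree_mul _ _).trans ?_
  have h3 := MvPolynomial.totalDegree_mul
    (MvPolynomial.C (hVol d (convexHull ℝ (x '' (F i : Set (Fin m)))) * uu i ^ s))
    (facetAdjoint d m x (F i) (T i))
  rw [MvPolynomial.totalDegree_C] at h3
  omega

/-- Let `P = conv{x_1,…,x_m} ⊆ ℝ^d` be a full-dimensional compact convex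
polytope (with the `x_k` its distinct vertices) whose facets `F_1,…,F_f` — the
`(d−1)`-dimensional faces, described by their vertex index sets `F i`, outer unit normals
`u i` and supporting levels `c i`, covering the boundary of `P` — are simplicial
polytopes, each triangulated by `T i`. Then, for every specialization `uu` of the
`u`-variables to real numbers, the surface adjoint `α_P^s` has total degree at most
`m − d` in `t_1,…,t_d` and vanishes at every point of `⋃_i NF(F_i)`, the union of the
nonface subspace arrangements of the facets. -/
theorem stmt_9 (d m f s : ℕ) (x : Fin m → EuclideanSpace ℝ (Fin d))
    (hfull : (interior (convexHull ℝ (Set.range x))).Nonempty)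
    (hinj : Function.Injective x)
    (hext : Set.extremePoints ℝ (convexHull ℝ (Set.range x)) = Set.range x)
    (F : Fin f → Finset (Fin m)) (u : Fin f → EuclideanSpace ℝ (Fin d)) (c : Fin f → ℝ)
    (hnorm : ∀ i, ‖u i‖ = 1)
    (hmem : ∀ i, ∀ k ∈ F i, ∑ j, x k j * u i j = c i)
    (hlt : ∀ i, ∀ k ∉ F i, ∑ j, x k j * u i j < c i)
    (hbound : ∀ p ∈ frontier (convexHull ℝ (Set.range x)),
      ∃ i, p ∈ convexHull ℝ (x '' ↑(F i)))
    (hinjF : Function.Injective F)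
    (T : ∀ i, FacetTri d m x (F i)) :
    ∀ uu : Fin f → ℝ,
      (surfaceAdjoint d m f s x F T uu).totalDegree ≤ m - d ∧
      ∀ i : Fin f, ∀ τ : Finset (Fin m), τ ⊆ F i →
        ¬ IsFaceVtxSetOfFacet d m x (F i) τ →
        ∀ t : Fin d → ℝ, (∀ k ∈ τ, 1 - ∑ j, x k j * t j = 0) →
          MvPolynomial.eval t (surfaceAdjoint d m f s x F T uu) = 0 := by
  refine fun uu => ⟨totalDegree_surfaceAdjoint_le x F T uu, fun i τ hτ hface t ht => ?_⟩
  rw [surfaceAdjoint, map_sum]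
  refine Finset.sum_eq_zero fun j _ => ?_
  rw [map_mul, map_mul]
  by_cases hτj : τ ⊆ F j
  · have hcut : ¬ CutsOut x (F j) τ := by
      intro h
      refine hface (((h.univ hτj
        (Fintype.linearCombination ℝ (u j).ofLp ∘ₗ
          (WithLp.linearEquiv 2 ℝ (Fin d → ℝ)).toLinearMap) (c j)
        ?_ ?_).mono (subset_univ _)).isFaceVtxSetOfFacet hτ)
      · intro k hk
        simpa [Fintype.linearCombination_apply] using hmem j k hk
      · intro k hk
        simpa [Fintype.linearCombination_apply] using hlt j k hk
    rw [eval_facetAdjoint_eq_zero (T j) (hnorm j) (hmem j) hτj hcut ht, mul_zero, zero_mul]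
  · obtain ⟨k, hk, hkj⟩ := not_subset.1 hτj
    rw [map_prod, Finset.prod_eq_zero (mem_compl.2 hkj) ((eval_Lpoly x k t).trans (ht k hk)),
      mul_zero]
end

section
/- Let P = conv{x_1,…,x_m} ⊂ ℝ^d be a full-dimensional simplicial polytope (every facet of P is a (d−1)-simplex, hence has exactly d vertices), fix integers r ≥ 1 and s ≥ 0, and define the rank r+s Minkowski surface tensor Φ_{d−1}^{r,s}(P) = (1/(r!·s!·ω_{1+s})) ∑_{F∈ℱ_{d−1}(P)} (∫_F x^{⊗r} H^{d−1}(dx)) ⊗ u_F^{⊗s}. For each tuple I = (i_1 ≤ ⋯ ≤ i_r) with entries in {1,…,d}, let a(I)_j = #{l : i_l = j}, and define c_I = ∑_{F∈ℱ_{d−1}(P)} V_{d−1}(F) · u_F^{⊗s} · [∑_{k=1}^{r} (−1)^{k+r} · k! · ∑_{π} ∏_{B∈π} e^{I_B}(F)], where the inner sum is over all partitions π of the position set {1,…,r} into k nonempty blocks each of size at most d, I_B = (i_l)_{l∈B}, and e^{I_B}(F) is the doubly indexed elementary symmetric function evaluated at the d vertices of F. Then Φ_{d−1}^{r,s}(P)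 = ((d−1)!/((r+d−1)!·s!·ω_{1+s})) · ∑_{I} (c_I/(a(I)_1!⋯a(I)_d!)) · e_1^{⊗a(I)_1} ⊗ ⋯ ⊗ e_d^{⊗a(I)_d}, the sum being over all weakly increasing tuples I of length r; equivalently, for every multi-index (a_1,…,a_d) with a_1+⋯+a_d = r, ∑_{F∈ℱ_{d−1}(P)} (∫_F x_1^{a_1}⋯x_d^{a_d} H^{d−1}(dx)) · u_F^{⊗s} = ((d−1)!/(r+d−1)!) · ∑_{F∈ℱ_{d−1}(P)} V_{d−1}(F)·u_F^{⊗s}·[∑_{k=1}^{r} (−1)^{k+r} k! ∑_{π} ∏_{B∈π} e^{I_B}(F)], where I is the weakly increasing tuple with multiplicities (a_1,…,a_d). -/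
open MeasureTheory Finset

open scoped Classical in
/-- The set of all partitions of the position set `{1,…,r}` (as `Fin r`) into `k`
pairwise disjoint nonempty blocks, each of size at most `d`. -/
noncomputable def partsKd (r k d : ℕ) : Finset (Finset (Finset (Fin r))) :=
  Finset.univ.filter (fun π => π.card = k ∧ (∀ B ∈ π, B.Nonempty ∧ B.card ≤ d) ∧
    (∀ B ∈ π, ∀ B' ∈ π, B ≠ B' → Disjoint B B') ∧ π.sup id = Finset.univ)

/-- The doubly indexed elementary symmetric function `e^{I_B}(y_1,…,y_d)
= (1/(d−|B|)!) ∑_{σ∈S_d} ∏_{l∈B} y_{σ(pos of l), i_l}` of the vertex list `y` of a facet,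
for the subtuple of `I = (i_1,…,i_r)` indexed by the block `B` of positions. -/
noncomputable def eSym (d : ℕ) (y : Fin d → EuclideanSpace ℝ (Fin d)) {r : ℕ}
    (I : Fin r → Fin d) (B : Finset (Fin r)) : ℝ :=
  if h : B.card ≤ d then
    (1 / Nat.factorial (d - B.card) : ℝ) *
      ∑ σ : Equiv.Perm (Fin d), ∏ p : Fin B.card,
        y (σ (Fin.castLE h p)) (I ↑(B.orderIsoOfFin rfl p))
  else 0

namespace SurfaceTensor

variable {ι J : Type*} [DecidableEq ι]

/-- The set partitions of a finite set, as families of nonempty pairwise disjoint blocks. -/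
def blockPartitions (S : Finset ι) : Finset (Finset (Finset ι)) :=
  S.powerset.powerset.filter fun π =>
    (∀ B ∈ π, B.Nonempty) ∧ (∀ B ∈ π, ∀ B' ∈ π, B ≠ B' → Disjoint B B') ∧ π.sup id = S

theorem mem_blockPartitions {S : Finset ι} {π : Finset (Finset ι)} :
    π ∈ blockPartitions S ↔ (∀ B ∈ π, B.Nonempty) ∧
      (∀ B ∈ π, ∀ B' ∈ π, B ≠ B' → Disjoint B B') ∧ π.sup id = S := by
  simp only [blockPartitions, mem_filter, mem_powerset, and_iff_right_iff_imp]
  rintro ⟨-, -, rfl⟩ B hB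
  exact mem_powerset.2 (le_sup (f := id) hB)

theorem sum_card_of_mem_blockPartitions {S : Finset ι} {π : Finset (Finset ι)}
    (h : π ∈ blockPartitions S) : ∑ B ∈ π, B.card = S.card := by
  obtain ⟨-, h2, h3⟩ := mem_blockPartitions.1 h
  rw [← h3, sup_eq_biUnion]
  exact (card_biUnion h2).symm

/-- The signed sum of `|π|! ∏ g(B)` over the set partitions of `S`. -/
def partitionSum (g : Finset ι → ℝ) (S : Finset ι) : ℝ :=
  ∑ π ∈ blockPartitions S, (-1 : ℝ) ^ π.card * π.card.factorial * ∏ B ∈ π, g B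

theorem partitionSum_empty (g : Finset ι → ℝ) : partitionSum g ∅ = 1 := by
  have : blockPartitions (∅ : Finset ι) = {∅} := by
    ext π
    rw [mem_blockPartitions, mem_singleton]
    constructor
    · rintro ⟨h1, -, h3⟩
      refine eq_empty_of_forall_notMem fun B hB => ?_
      have := le_sup (f := id) hB
      rw [h3] at this
      exact (h1 B hB).ne_empty (subset_empty.1 this)
    · rintro rfl
      simp
  simp [partitionSum, this]

theorem erase_mem_blockPartitions {S B : Finset ι} {π : Finset (Finset ι)}
    (h : π ∈ blockPartitions S) (hB : B ∈ π) : π.erase B ∈ blockPartitions (S \ B) := by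
  obtain ⟨h1, h2, h3⟩ := mem_blockPartitions.1 h
  refine mem_blockPartitions.2 ⟨fun C hC => h1 C (mem_of_mem_erase hC),
    fun C hC D hD => h2 C (mem_of_mem_erase hC) D (mem_of_mem_erase hD), ?_⟩
  rw [← h3]
  ext l
  simp only [mem_sup, mem_erase, id, mem_sdiff]
  constructor
  · rintro ⟨C, ⟨hCB, hC⟩, hl⟩
    exact ⟨⟨C, hC, hl⟩, disjoint_left.1 (h2 C hC B hB hCB) hl⟩
  · rintro ⟨⟨C, hC, hl⟩, hlB⟩
    exact ⟨C, ⟨fun e => hlB (e ▸ hl), hC⟩, hl⟩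

theorem notMem_of_mem_blockPartitions_sdiff {S B : Finset ι} {π : Finset (Finset ι)}
    (h : π ∈ blockPartitions (S \ B)) (hB : B.Nonempty) : B ∉ π := by
  intro hBπ
  obtain ⟨-, -, h3⟩ := mem_blockPartitions.1 h
  obtain ⟨l, hl⟩ := hB
  have : l ∈ S \ B := h3 ▸ mem_sup.2 ⟨B, hBπ, hl⟩
  exact (mem_sdiff.1 this).2 hl

theorem insert_mem_blockPartitions {S B : Finset ι} {π : Finset (Finset ι)}
    (h : π ∈ blockPartitions (S \ B)) (hB : B.Nonempty) (hBS : B ⊆ S) :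
    insert B π ∈ blockPartitions S := by
  obtain ⟨h1, h2, h3⟩ := mem_blockPartitions.1 h
  have hd : ∀ C ∈ π, Disjoint C B := fun C hC =>
    disjoint_left.2 fun l hl => (mem_sdiff.1 (h3 ▸ mem_sup.2 ⟨C, hC, hl⟩ : l ∈ S \ B)).2
  refine mem_blockPartitions.2 ⟨?_, ?_, ?_⟩
  · intro C hC
    rcases mem_insert.1 hC with rfl | hC
    · exact hB
    · exact h1 C hC
  · intro C hC D hD hne
    rcases mem_insert.1 hC with rfl | hC' <;> rcases mem_insert.1 hD with rfl | hD'
    · exact absurd rfl hne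
    · exact (hd D hD').symm
    · exact hd C hC'
    · exact h2 C hC' D hD' hne
  · rw [sup_insert, h3]
    exact union_sdiff_of_subset hBS

theorem partitionSum_eq_neg_sum (g : Finset ι → ℝ) {S : Finset ι} (hS : S.Nonempty) :
    partitionSum g S =
      -∑ B ∈ S.powerset.filter (·.Nonempty), g B * partitionSum g (S \ B) := by
  have key : ∀ π ∈ blockPartitions S,
      (-1 : ℝ) ^ π.card * π.card.factorial * ∏ B ∈ π, g B =
        ∑ B ∈ π, -(g B * ((-1 : ℝ) ^ (π.erase B).card * (π.erase B).card.factorial *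
          ∏ C ∈ π.erase B, g C)) := by
    intro π hπ
    have hne : π.Nonempty := by
      rw [nonempty_iff_ne_empty]
      rintro rfl
      have := (mem_blockPartitions.1 hπ).2.2
      rw [sup_empty] at this
      exact hS.ne_empty this.symm
    have hterm : ∀ B ∈ π, -(g B * ((-1 : ℝ) ^ (π.erase B).card * (π.erase B).card.factorial *
          ∏ C ∈ π.erase B, g C)) =
        (-1 : ℝ) ^ π.card * (π.card - 1).factorial * ∏ C ∈ π, g C := by
      intro B hB
      rw [← mul_prod_erase π g hB, card_erase_of_mem hB]
      have : (-1 : ℝ) ^ π.card = -(-1 : ℝ) ^ (π.card - 1) := by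
        conv_lhs => rw [← Nat.sub_add_cancel hne.card_pos, pow_succ]
        ring
      rw [this]
      ring
    rw [sum_congr rfl hterm, sum_const, nsmul_eq_mul,
      ← Nat.mul_factorial_pred hne.card_pos.ne']
    push_cast
    ring
  rw [partitionSum, sum_congr rfl key, ← sum_neg_distrib]
  simp only [partitionSum, mul_sum, ← sum_neg_distrib]
  rw [sum_sigma', sum_sigma']
  refine sum_bij' (fun p _ => ⟨p.2, p.1.erase p.2⟩) (fun p _ => ⟨insert p.1 p.2, p.1⟩)
    ?_ ?_ ?_ ?_ ?_
  · rintro ⟨π, B⟩ h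
    obtain ⟨hπ, hB⟩ := mem_sigma.1 h
    obtain ⟨h1, -, h3⟩ := mem_blockPartitions.1 hπ
    refine mem_sigma.2 ⟨mem_filter.2 ⟨mem_powerset.2 ?_, h1 B hB⟩,
      erase_mem_blockPartitions hπ hB⟩
    rw [← h3]
    exact le_sup (f := id) hB
  · rintro ⟨B, π⟩ h
    obtain ⟨hB, hπ⟩ := mem_sigma.1 h
    obtain ⟨hBS, hne⟩ := mem_filter.1 hB
    exact mem_sigma.2 ⟨insert_mem_blockPartitions hπ hne (mem_powerset.1 hBS),
      mem_insert_self _ _⟩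
  · rintro ⟨π, B⟩ h
    simp [insert_erase (mem_sigma.1 h).2]
  · rintro ⟨B, π⟩ h
    obtain ⟨hB, hπ⟩ := mem_sigma.1 h
    have := notMem_of_mem_blockPartitions_sdiff hπ (mem_filter.1 hB).2
    simp [erase_insert this]
  · rintro ⟨π, B⟩ h
    rfl

section MapsOn

variable [Fintype ι] [Fintype J]

/-- The maps `ι → J` taking the default value `j₀` outside `S`. -/
def mapsOn (j₀ : J) (S : Finset ι) : Finset (ι → J) :=
  Fintype.piFinset fun l => if l ∈ S then univ else {j₀}

theorem mem_mapsOn {j₀ : J} {S : Finset ι} {φ : ι → J} :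
    φ ∈ mapsOn j₀ S ↔ ∀ l ∉ S, φ l = j₀ := by
  rw [mapsOn, Fintype.mem_piFinset]
  refine forall_congr' fun l => ?_
  by_cases h : l ∈ S <;> simp [h]

theorem sum_mapsOn_mul_sum_mapsOn (j₀ : J) {S B : Finset ι} (hBS : B ⊆ S)
    (f g : (ι → J) → ℝ) (hf : ∀ φ ψ : ι → J, (∀ l ∈ B, φ l = ψ l) → f φ = f ψ)
    (hg : ∀ φ ψ : ι → J, (∀ l ∈ S \ B, φ l = ψ l) → g φ = g ψ) :
    (∑ φ ∈ mapsOn j₀ B, f φ) * ∑ φ ∈ mapsOn j₀ (S \ B), g φ =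
      ∑ φ ∈ mapsOn j₀ S, f φ * g φ := by
  rw [sum_mul_sum, ← sum_product']
  refine sum_nbij' (fun p => B.piecewise p.1 p.2)
    (fun φ => (B.piecewise φ fun _ => j₀, (S \ B).piecewise φ fun _ => j₀)) ?_ ?_ ?_ ?_ ?_
  · rintro ⟨φ, ψ⟩ h
    obtain ⟨-, h2⟩ := mem_product.1 h
    refine mem_mapsOn.2 fun l hl => ?_
    rw [piecewise_eq_of_notMem _ _ _ fun h => hl (hBS h)]
    exact mem_mapsOn.1 h2 l fun h => hl (mem_sdiff.1 h).1
  · intro φ _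
    exact mem_product.2
      ⟨mem_mapsOn.2 fun l hl => piecewise_eq_of_notMem B φ (fun _ => j₀) hl,
        mem_mapsOn.2 fun l hl => piecewise_eq_of_notMem (S \ B) φ (fun _ => j₀) hl⟩
  · rintro ⟨φ, ψ⟩ h
    obtain ⟨h1, h2⟩ := mem_product.1 h
    simp only at h1 h2
    rw [mem_mapsOn] at h1 h2
    refine Prod.ext (funext fun l => ?_) (funext fun l => ?_)
    · by_cases hl : l ∈ B
      · simp [hl]
      · simp [hl, h1]
    · by_cases hl : l ∈ S \ B
      · simp [hl, (mem_sdiff.1 hl).2]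
      · simp only [piecewise_eq_of_notMem _ _ _ hl]
        exact (h2 l hl).symm
  · intro φ h
    rw [mem_mapsOn] at h
    refine funext fun l => ?_
    by_cases hl : l ∈ B
    · simp [hl]
    · by_cases hS : l ∈ S
      · simp [hl, hS]
      · simp [hl, hS, h l hS]
  · rintro ⟨φ, ψ⟩ -
    rw [hf (B.piecewise φ ψ) φ fun l hl => piecewise_eq_of_mem _ _ _ hl,
      hg (B.piecewise φ ψ) ψ fun l hl => piecewise_eq_of_notMem _ _ _ (mem_sdiff.1 hl).2]

theorem mapsOn_empty (j₀ : J) : mapsOn j₀ (∅ : Finset ι) = {fun _ => j₀} := by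
  ext φ
  simp [mem_mapsOn, funext_iff]

end MapsOn

variable [Fintype J] [DecidableEq J]

/-- The product of the factorials of the fibre sizes of `φ` on `S`. -/
def fiberFactorial (φ : ι → J) (S : Finset ι) : ℝ :=
  ∏ j, ((S.filter fun l => φ l = j).card.factorial : ℝ)

theorem fiberFactorial_insert_sdiff (φ : ι → J) {S B : Finset ι} {l : ι} (hl : l ∈ S)
    (hB : ∀ b ∈ B, φ b ≠ φ l) :
    ((S.filter fun k => φ k = φ l).card : ℝ) * fiberFactorial φ (S \ insert l B) =
      fiberFactorial φ (S \ B) := by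
  have h1 : (S \ insert l B).filter (fun k => φ k = φ l) =
      (S.filter fun k => φ k = φ l).erase l := by
    ext k
    simp only [mem_filter, mem_sdiff, mem_insert, mem_erase, not_or]
    exact ⟨fun ⟨⟨h, h', _⟩, e⟩ => ⟨h', h, e⟩,
      fun ⟨h', h, e⟩ => ⟨⟨h, h', fun hk => hB k hk e⟩, e⟩⟩
  have h2 : (S \ B).filter (fun k => φ k = φ l) = S.filter fun k => φ k = φ l := by
    ext k
    simp only [mem_filter, mem_sdiff]
    exact ⟨fun ⟨⟨h, _⟩, e⟩ => ⟨h, e⟩, fun ⟨h, e⟩ => ⟨⟨h, fun hk => hB k hk e⟩, e⟩⟩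
  have hmem : l ∈ S.filter fun k => φ k = φ l := by simp [hl]
  rw [fiberFactorial, fiberFactorial, ← mul_prod_erase univ _ (mem_univ (φ l)),
    ← mul_prod_erase univ _ (mem_univ (φ l)), h1, h2, card_erase_of_mem hmem, ← mul_assoc,
    ← Nat.mul_factorial_pred (card_pos.2 ⟨l, hmem⟩).ne']
  push_cast
  congr 1
  refine prod_congr rfl fun j hj => ?_
  congr 3
  ext k
  simp only [mem_filter, mem_sdiff, mem_insert, not_or]
  refine ⟨fun ⟨⟨h, _, h'⟩, e⟩ => ⟨⟨h, h'⟩, e⟩, fun ⟨⟨h, h'⟩, e⟩ => ⟨⟨h, ?_, h'⟩, e⟩⟩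
  rintro rfl
  exact (mem_erase.1 hj).1 e.symm

open scoped Classical in
theorem sum_injOn_fiberFactorial (φ : ι → J) {S : Finset ι} (hS : S.Nonempty) :
    ∑ B ∈ S.powerset.filter (fun B : Finset ι => Set.InjOn φ (B : Set ι)),
      (-1 : ℝ) ^ B.card * fiberFactorial φ (S \ B) = 0 := by
  obtain ⟨l₀, hl₀⟩ := hS
  set T := S.filter fun k => φ k = φ l₀ with hT
  have hTpos : 0 < T.card := card_pos.2 ⟨l₀, by simp [hT, hl₀]⟩
  rw [← sum_filter_add_sum_filter_not _ (fun B => ∀ b ∈ B, φ b ≠ φ l₀)]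
  have hsec : ∑ B ∈ (S.powerset.filter (fun B : Finset ι => Set.InjOn φ (B : Set ι))).filter
        (fun B => ¬ ∀ b ∈ B, φ b ≠ φ l₀), (-1 : ℝ) ^ B.card * fiberFactorial φ (S \ B) =
      ∑ B ∈ (S.powerset.filter (fun B : Finset ι => Set.InjOn φ (B : Set ι))).filter
        (fun B => ∀ b ∈ B, φ b ≠ φ l₀), ∑ l ∈ T,
          (-1 : ℝ) ^ (insert l B).card * fiberFactorial φ (S \ insert l B) := by
    rw [sum_sigma']
    symm
    refine sum_bij (fun p _ => insert p.2 p.1) ?_ ?_ ?_ ?_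
    · rintro ⟨B, l⟩ h
      simp only [mem_sigma, mem_filter, mem_powerset, hT] at h
      obtain ⟨⟨⟨hBS, hinj⟩, hB⟩, hlS, hl⟩ := h
      simp only [mem_filter, mem_powerset, not_forall]
      refine ⟨⟨insert_subset hlS hBS, ?_⟩, l, mem_insert_self _ _, by simp [hl]⟩
      rw [coe_insert, Set.injOn_insert (fun hlB => hB l hlB hl)]
      refine ⟨hinj, ?_⟩
      rintro ⟨b, hb, hbl⟩
      exact hB b hb (hbl.trans hl)
    · rintro ⟨B, l⟩ h ⟨B', l'⟩ h' heq
      simp only [mem_sigma, mem_filter, mem_powerset, hT] at h h'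
      simp only at heq
      have hlB : l ∉ B := fun hlB => h.1.2 l hlB h.2.2
      have hlB' : l' ∉ B' := fun hlB => h'.1.2 l' hlB h'.2.2
      have hll : l = l' := by
        have : l ∈ insert l' B' := heq ▸ mem_insert_self l B
        rcases mem_insert.1 this with e | e
        · exact e
        · exact absurd h.2.2 (h'.1.2 l e)
      subst hll
      rw [← erase_insert hlB, heq, erase_insert hlB']
    · intro B h
      simp only [mem_filter, mem_powerset, not_forall, not_not] at h
      obtain ⟨⟨hBS, hinj⟩, l, hl, hφ⟩ := h
      refine ⟨⟨B.erase l, l⟩, ?_, insert_erase hl⟩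
      simp only [mem_sigma, mem_filter, mem_powerset, hT]
      refine ⟨⟨⟨(erase_subset _ _).trans hBS, hinj.mono (by simp)⟩, ?_⟩, hBS hl, hφ⟩
      intro b hb hbφ
      exact (mem_erase.1 hb).1 (hinj (mem_of_mem_erase hb) hl (hbφ.trans hφ.symm))
    · intro p _
      rfl
  rw [hsec, ← sum_add_distrib]
  refine sum_eq_zero fun B hB => ?_
  simp only [mem_filter, mem_powerset] at hB
  have : ∀ l ∈ T, (-1 : ℝ) ^ (insert l B).card * fiberFactorial φ (S \ insert l B) =
      -((-1 : ℝ) ^ B.card * fiberFactorial φ (S \ B) / T.card) := by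
    intro l hl
    obtain ⟨hlS, hlφ⟩ := mem_filter.1 hl
    have hlB : ∀ b ∈ B, φ b ≠ φ l := fun b hb => hlφ ▸ hB.2 b hb
    rw [card_insert_of_notMem (fun h => hlB l h rfl), ← fiberFactorial_insert_sdiff φ hlS hlB,
      hlφ, ← hT]
    have : (T.card : ℝ) ≠ 0 := by positivity
    field_simp
    ring
  rw [sum_congr rfl this, sum_const, nsmul_eq_mul]
  have : (T.card : ℝ) ≠ 0 := by positivity
  field_simp
  ring


variable [Fintype ι]

open scoped Classical in
/-- The multilinear elementary symmetric function: the sum of `∏ c l (φ l)` over the maps `φ`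
injective on `B`. -/
def injectiveSum (c : ι → J → ℝ) (j₀ : J) (B : Finset ι) : ℝ :=
  ∑ φ ∈ mapsOn j₀ B, if Set.InjOn φ (B : Set ι) then ∏ l ∈ B, c l (φ l) else 0

/-- The multilinear complete homogeneous symmetric function, with multiplicities. -/
def factorialSum (c : ι → J → ℝ) (j₀ : J) (S : Finset ι) : ℝ :=
  ∑ φ ∈ mapsOn j₀ S, fiberFactorial φ S * ∏ l ∈ S, c l (φ l)

theorem injectiveSum_empty (c : ι → J → ℝ) (j₀ : J) : injectiveSum c j₀ ∅ = 1 := by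
  simp [injectiveSum, mapsOn_empty]

theorem factorialSum_empty (c : ι → J → ℝ) (j₀ : J) : factorialSum c j₀ ∅ = 1 := by
  simp [factorialSum, mapsOn_empty, fiberFactorial]

theorem sum_injectiveSum_mul_factorialSum (c : ι → J → ℝ) (j₀ : J) {S : Finset ι}
    (hS : S.Nonempty) :
    ∑ B ∈ S.powerset, (-1 : ℝ) ^ B.card * injectiveSum c j₀ B * factorialSum c j₀ (S \ B) =
      0 := by
  classical
  have key : ∀ B ∈ S.powerset,
      (-1 : ℝ) ^ B.card * injectiveSum c j₀ B * factorialSum c j₀ (S \ B) =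
        ∑ φ ∈ mapsOn j₀ S, if Set.InjOn φ (B : Set ι) then
          (∏ l ∈ S, c l (φ l)) * ((-1 : ℝ) ^ B.card * fiberFactorial φ (S \ B)) else 0 := by
    intro B hB
    have hBS := mem_powerset.1 hB
    rw [mul_assoc, injectiveSum, factorialSum, sum_mapsOn_mul_sum_mapsOn j₀ hBS, mul_sum]
    · refine sum_congr rfl fun φ _ => ?_
      split_ifs
      · rw [← prod_sdiff hBS]
        ring
      · simp
    · intro φ ψ h
      have h1 : Set.InjOn φ (B : Set ι) ↔ Set.InjOn ψ (B : Set ι) :=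
        Set.EqOn.injOn_iff fun l hl => h l hl
      have h2 : ∏ l ∈ B, c l (φ l) = ∏ l ∈ B, c l (ψ l) :=
        prod_congr rfl fun l hl => by rw [h l hl]
      simp only [h1, h2]
    · intro φ ψ h
      have h1 : fiberFactorial φ (S \ B) = fiberFactorial ψ (S \ B) :=
        prod_congr rfl fun j _ => by
          rw [filter_congr fun l hl => by rw [h l hl]]
      rw [h1, prod_congr rfl fun l hl => by rw [h l hl]]
  rw [sum_congr rfl key, sum_comm]
  refine sum_eq_zero fun φ _ => ?_
  rw [← sum_filter, ← mul_sum, sum_injOn_fiberFactorial φ hS, mul_zero]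

theorem factorialSum_eq_partitionSum (c : ι → J → ℝ) (j₀ : J) (S : Finset ι) :
    factorialSum c j₀ S = partitionSum (fun B => (-1 : ℝ) ^ B.card * injectiveSum c j₀ B) S := by
  induction S using Finset.strongInduction with
  | H S ih =>
  rcases S.eq_empty_or_nonempty with rfl | hS
  · rw [factorialSum_empty, partitionSum_empty]
  · rw [partitionSum_eq_neg_sum _ hS]
    have h := sum_injectiveSum_mul_factorialSum c j₀ hS
    rw [← sum_filter_add_sum_filter_not _ (·.Nonempty)] at h
    have h0 : S.powerset.filter (fun B => ¬ B.Nonempty) = {∅} := by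
      ext B
      simp only [mem_filter, mem_powerset, not_nonempty_iff_eq_empty, mem_singleton,
        and_iff_right_iff_imp]
      rintro rfl
      exact empty_subset _
    rw [h0, sum_singleton, card_empty, pow_zero, injectiveSum_empty, sdiff_empty] at h
    have h1 : ∑ B ∈ S.powerset.filter (·.Nonempty),
        (-1 : ℝ) ^ B.card * injectiveSum c j₀ B * factorialSum c j₀ (S \ B) =
        ∑ B ∈ S.powerset.filter (·.Nonempty), (-1 : ℝ) ^ B.card * injectiveSum c j₀ B *
          partitionSum (fun B => (-1 : ℝ) ^ B.card * injectiveSum c j₀ B) (S \ B) := by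
      refine sum_congr rfl fun B hB => ?_
      obtain ⟨hBS, hne⟩ := mem_filter.1 hB
      rw [ih _ (sdiff_ssubset (mem_powerset.1 hBS) hne)]
    rw [← h1]
    linarith

theorem card_perm_extending {d b : ℕ} (h : b ≤ d) (f : Fin b → Fin d)
    (hf : Function.Injective f) :
    (univ.filter fun σ : Equiv.Perm (Fin d) => ∀ p, σ (Fin.castLE h p) = f p).card =
      (d - b).factorial := by
  classical
  have hmem : ∀ x : Fin d, x.1 < b ↔ x ∈ Set.range (Fin.castLE h) := fun x => by simp
  obtain ⟨τ, hτ⟩ : ∃ τ : Equiv.Perm (Fin d), ∀ p, τ (Fin.castLE h p) = f p := by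
    let e : {x // x ∈ Set.range (Fin.castLE h)} ≃ {x // x ∈ Set.range f} :=
      (Equiv.ofInjective _ (Fin.castLE_injective h)).symm.trans (Equiv.ofInjective f hf)
    refine ⟨e.extendSubtype, fun p => ?_⟩
    rw [Equiv.extendSubtype_apply_of_mem _ _ ⟨p, rfl⟩]
    simp only [e, Equiv.trans_apply]
    rw [show (⟨Fin.castLE h p, ⟨p, rfl⟩⟩ : {x // x ∈ Set.range (Fin.castLE h)}) =
      Equiv.ofInjective _ (Fin.castLE_injective h) p from rfl, Equiv.symm_apply_apply]
    rfl
  have h1 : (univ.filter fun σ : Equiv.Perm (Fin d) => ∀ p, σ (Fin.castLE h p) = f p).card =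
      Fintype.card {σ : Equiv.Perm (Fin d) // ∀ a, ¬ (¬ a.1 < b) → σ a = a} := by
    rw [Fintype.card_subtype]
    refine card_nbij' (fun σ => τ⁻¹ * σ) (fun σ => τ * σ) ?_ ?_ ?_ ?_
    · intro σ hσ
      simp only [coe_filter, mem_univ, true_and, Set.mem_ofPred_eq, not_not] at hσ ⊢
      intro a ha
      have := hσ ⟨a, ha⟩
      rw [← hτ] at this
      rw [Equiv.Perm.mul_apply, Equiv.Perm.inv_eq_iff_eq]
      exact this
    · intro σ hσ
      simp only [coe_filter, mem_univ, true_and, Set.mem_ofPred_eq, not_not] at hσ ⊢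
      intro p
      rw [Equiv.Perm.mul_apply, hσ _ (by simp), hτ]
    · intro σ _
      simp
    · intro σ _
      simp
  rw [h1, ← Fintype.card_congr (Equiv.Perm.subtypeEquivSubtypePerm fun a : Fin d => ¬ a.1 < b),
    Fintype.card_perm, Fintype.card_subtype_compl, Fintype.card_fin]
  congr 2
  rw [Fintype.card_congr (Equiv.subtypeEquivRight hmem),
    ← Fintype.card_congr (Equiv.ofInjective _ (Fin.castLE_injective h)), Fintype.card_fin]

theorem eSym_eq_injectiveSum {d r : ℕ} (y : Fin d → EuclideanSpace ℝ (Fin d))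
    (I : Fin r → Fin d) (j₀ : Fin d) (B : Finset (Fin r)) :
    eSym d y I B = injectiveSum (fun l j => y j (I l)) j₀ B := by
  classical
  rw [eSym, injectiveSum]
  split_ifs with h
  · have hmaps : ∀ σ ∈ (univ : Finset (Equiv.Perm (Fin d))),
        (fun l => if hl : l ∈ B then σ (Fin.castLE h ((B.orderIsoOfFin rfl).symm ⟨l, hl⟩))
          else j₀) ∈ (mapsOn j₀ B).filter (fun φ => Set.InjOn φ (B : Set (Fin r))) := by
      intro σ _
      refine mem_filter.2 ⟨mem_mapsOn.2 fun l hl => dif_neg hl, fun l hl k hk e => ?_⟩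
      rw [mem_coe] at hl hk
      simp only [hl, hk, dif_pos] at e
      have := (B.orderIsoOfFin rfl).symm.injective (Fin.castLE_injective h (σ.injective e))
      exact congrArg Subtype.val this
    rw [← sum_filter, ← sum_fiberwise_of_maps_to hmaps, mul_sum]
    refine sum_congr rfl fun φ hφ => ?_
    obtain ⟨hφ1, hφ2⟩ := mem_filter.1 hφ
    have hiff : ∀ σ : Equiv.Perm (Fin d),
        (fun l => if hl : l ∈ B then σ (Fin.castLE h ((B.orderIsoOfFin rfl).symm ⟨l, hl⟩))
          else j₀) = φ ↔ ∀ p, σ (Fin.castLE h p) = φ (B.orderIsoOfFin rfl p) := by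
      intro σ
      constructor
      · rintro rfl p
        dsimp only
        rw [dif_pos (B.orderIsoOfFin rfl p).2, Subtype.coe_eta, OrderIso.symm_apply_apply]
      · intro hσ
        funext l
        by_cases hl : l ∈ B
        · simp [hl, hσ]
        · simp [hl, mem_mapsOn.1 hφ1 l hl]
    have hinj : Function.Injective fun p => φ (B.orderIsoOfFin rfl p) := fun p q e =>
      (B.orderIsoOfFin rfl).injective
        (Subtype.ext (hφ2 (B.orderIsoOfFin rfl p).2 (B.orderIsoOfFin rfl q).2 e))
    rw [filter_congr fun σ _ => hiff σ]
    have hterm : ∀ σ ∈ univ.filter (fun σ : Equiv.Perm (Fin d) =>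
        ∀ p, σ (Fin.castLE h p) = φ (B.orderIsoOfFin rfl p)),
        ∏ p : Fin B.card, y (σ (Fin.castLE h p)) (I ↑(B.orderIsoOfFin rfl p)) =
          ∏ l ∈ B, y (φ l) (I l) := by
      intro σ hσ
      simp only [mem_filter, mem_univ, true_and] at hσ
      simp only [hσ]
      exact ((B.orderIsoOfFin rfl).toEquiv.prod_comp
        (fun l : {x // x ∈ B} => y (φ l) (I l))).trans (prod_coe_sort B fun l => y (φ l) (I l))
    rw [sum_congr rfl hterm, sum_const, card_perm_extending h _ hinj, nsmul_eq_mul]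
    have : ((d - B.card).factorial : ℝ) ≠ 0 := by positivity
    field_simp
  · symm
    refine sum_eq_zero fun φ _ => if_neg fun hinj => h ?_
    simpa using card_le_card_of_injOn φ (fun _ _ => mem_univ _) hinj

theorem alternating_sum_partsKd_eq {d r : ℕ} (hr : 1 ≤ r)
    (y : Fin d → EuclideanSpace ℝ (Fin d)) (I : Fin r → Fin d) (j₀ : Fin d) :
    ∑ k ∈ Finset.Icc 1 r, (-1 : ℝ) ^ (k + r) * Nat.factorial k *
        ∑ π ∈ partsKd r k d, ∏ B ∈ π, eSym d y I B =
      ∑ φ : Fin r → Fin d, fiberFactorial φ univ * ∏ l, y (φ l) (I l) := by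
  classical
  have hR : ∑ φ : Fin r → Fin d, fiberFactorial φ univ * ∏ l, y (φ l) (I l) =
      factorialSum (fun l j => y j (I l)) j₀ univ := by
    have : mapsOn j₀ (univ : Finset (Fin r)) = univ := by
      ext φ
      simp [mem_mapsOn]
    rw [factorialSum, this]
  have hmaps : ∀ π ∈ blockPartitions (univ : Finset (Fin r)), π.card ∈ Finset.Icc 1 r := by
    intro π hπ
    obtain ⟨h1, -, h3⟩ := mem_blockPartitions.1 hπ
    refine Finset.mem_Icc.2 ⟨card_pos.2 (nonempty_iff_ne_empty.2 ?_), ?_⟩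
    · rintro rfl
      have : (⟨0, hr⟩ : Fin r) ∈ (∅ : Finset (Finset (Fin r))).sup id := h3 ▸ mem_univ _
      simp at this
    · have h := sum_card_of_mem_blockPartitions hπ
      rw [card_univ, Fintype.card_fin] at h
      rw [card_eq_sum_ones]
      exact (sum_le_sum fun B hB => card_pos.2 (h1 B hB)).trans h.le
  rw [hR, factorialSum_eq_partitionSum, partitionSum, ← sum_fiberwise_of_maps_to hmaps]
  refine sum_congr rfl fun k _ => ?_
  rw [mul_sum]
  have hsub : partsKd r k d ⊆
      (blockPartitions (univ : Finset (Fin r))).filter fun π => π.card = k := by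
    intro π hπ
    rw [partsKd, mem_filter] at hπ
    obtain ⟨-, h1, h2, h3, h4⟩ := hπ
    exact mem_filter.2 ⟨mem_blockPartitions.2 ⟨fun B hB => (h2 B hB).1, h3, by convert h4⟩, h1⟩
  rw [← sum_subset hsub]
  · refine sum_congr rfl fun π hπ => ?_
    obtain ⟨hπ, hk⟩ := mem_filter.1 (hsub hπ)
    rw [prod_mul_distrib, prod_pow_eq_pow_sum, sum_card_of_mem_blockPartitions hπ, card_univ,
      Fintype.card_fin, hk, pow_add]
    simp only [eSym_eq_injectiveSum y I j₀]
    ring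
  · intro π hπ hnot
    obtain ⟨hπ, hk⟩ := mem_filter.1 hπ
    obtain ⟨h1, h2, h3⟩ := mem_blockPartitions.1 hπ
    obtain ⟨B, hB, hBd⟩ : ∃ B ∈ π, ¬ B.card ≤ d := by
      by_contra! hcon
      refine hnot ?_
      rw [partsKd, mem_filter]
      exact ⟨mem_univ _, hk, fun B hB => ⟨h1 B hB, hcon B hB⟩, h2, by convert h3⟩
    rw [prod_eq_zero hB, mul_zero]
    rw [← eSym_eq_injectiveSum, eSym, dif_neg hBd, mul_zero]

section Dirichlet

/-- The density `x ^ a * exp (-x)` on the half-line. -/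
noncomputable def gammaWeight (a : ℕ) : ℝ → ℝ :=
  (Set.Ici 0).indicator fun x => x ^ a * Real.exp (-x)

theorem measurable_gammaWeight (a : ℕ) : Measurable (gammaWeight a) :=
  Measurable.indicator (by fun_prop) measurableSet_Ici

theorem gammaWeight_nonneg (a : ℕ) (x : ℝ) : 0 ≤ gammaWeight a x :=
  Set.indicator_nonneg (fun x (hx : 0 ≤ x) => by positivity) x

theorem integrable_gammaWeight (a : ℕ) : Integrable (gammaWeight a) := by
  rw [gammaWeight, integrable_indicator_iff measurableSet_Ici, integrableOn_Ici_iff_integrableOn_Ioi]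
  refine (Real.GammaIntegral_convergent (s := a + 1) (by positivity)).congr_fun
    (fun x _ => ?_) measurableSet_Ioi
  simp [mul_comm]

theorem gammaWeight_of_not_nonneg (a : ℕ) {x : ℝ} (hx : ¬ 0 ≤ x) : gammaWeight a x = 0 :=
  Set.indicator_of_notMem (s := Set.Ici 0) hx _

theorem setIntegral_pow_mul_exp_neg (a : ℕ) :
    ∫ x in Set.Ioi (0 : ℝ), x ^ a * Real.exp (-x) = a.factorial := by
  rw [← Real.Gamma_nat_eq_factorial, Real.Gamma_eq_integral (by positivity)]
  refine setIntegral_congr_fun measurableSet_Ioi fun x _ => ?_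
  simp [mul_comm]

theorem integral_gammaWeight (a : ℕ) : ∫ x, gammaWeight a x = a.factorial := by
  rw [gammaWeight, integral_indicator measurableSet_Ici, integral_Ici_eq_integral_Ioi,
    setIntegral_pow_mul_exp_neg]

/-- The simplex spanned by the origin and the standard basis vectors. -/
def cornerSimplex (n : ℕ) : Set (Fin n → ℝ) :=
  {t | (∀ i, 0 ≤ t i) ∧ ∑ i, t i ≤ 1}

theorem isClosed_cornerSimplex (n : ℕ) : IsClosed (cornerSimplex n) := by
  refine IsClosed.inter (s₁ := {t : Fin n → ℝ | ∀ i, 0 ≤ t i})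
    (s₂ := {t : Fin n → ℝ | ∑ i, t i ≤ 1}) ?_ ?_
  · simp only [Set.ofPred_forall]
    exact isClosed_iInter fun i => isClosed_le continuous_const (continuous_apply i)
  · exact isClosed_le (by fun_prop) continuous_const

theorem isCompact_cornerSimplex (n : ℕ) : IsCompact (cornerSimplex n) := by
  refine (isCompact_Icc (a := (0 : Fin n → ℝ)) (b := 1)).of_isClosed_subset
    (isClosed_cornerSimplex n) fun t ht => ⟨fun i => ht.1 i, fun i => ?_⟩
  exact (single_le_sum (fun j _ => ht.1 j) (mem_univ i)).trans ht.2

variable {n : ℕ}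

theorem prod_gammaWeight_mul_gammaWeight_smul (a₀ : ℕ) (a : Fin n → ℕ) {u : ℝ} (hu : 0 < u)
    (t : Fin n → ℝ) :
    (∏ i, gammaWeight (a i) ((u • t) i)) * gammaWeight a₀ (u - ∑ i, (u • t) i) =
      u ^ (a₀ + ∑ i, a i) * Real.exp (-u) *
        (cornerSimplex n).indicator (fun t => (1 - ∑ i, t i) ^ a₀ * ∏ i, t i ^ a i) t := by
  have hsub : u - ∑ i, (u • t) i = u * (1 - ∑ i, t i) := by
    simp [mul_sub, mul_sum]
  by_cases ht : t ∈ cornerSimplex n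
  · rw [Set.indicator_of_mem ht, hsub]
    have h0 : 0 ≤ u * (1 - ∑ i, t i) := mul_nonneg hu.le (by linarith [ht.2])
    have hi : ∀ i, gammaWeight (a i) ((u • t) i) =
        u ^ a i * t i ^ a i * Real.exp (-(u * t i)) := by
      intro i
      have : (u • t) i ∈ Set.Ici (0 : ℝ) := mul_nonneg hu.le (ht.1 i)
      rw [gammaWeight, Set.indicator_of_mem this]
      simp [mul_pow]
    have he : Real.exp (-u) =
        (∏ i, Real.exp (-(u * t i))) * Real.exp (-(u * (1 - ∑ i, t i))) := by
      rw [← Real.exp_sum, ← Real.exp_add, sum_neg_distrib, ← mul_sum]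
      ring_nf
    rw [prod_congr rfl fun i _ => hi i, gammaWeight, Set.indicator_of_mem (Set.mem_Ici.2 h0), he,
      prod_mul_distrib, prod_mul_distrib, prod_pow_eq_pow_sum, mul_pow, pow_add]
    ring
  · rw [Set.indicator_of_notMem ht, mul_zero]
    by_cases h : ∀ i, 0 ≤ t i
    · have h1 : ¬ 0 ≤ u * (1 - ∑ i, t i) := fun h1 =>
        ht ⟨h, by linarith [nonneg_of_mul_nonneg_right h1 hu]⟩
      rw [hsub, gammaWeight_of_not_nonneg a₀ h1, mul_zero]
    · push Not at h
      obtain ⟨i, hi⟩ := h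
      have h1 : ¬ 0 ≤ (u • t) i := by
        rw [Pi.smul_apply, smul_eq_mul, not_le]
        exact mul_neg_of_pos_of_neg hu hi
      rw [prod_eq_zero (mem_univ i) (gammaWeight_of_not_nonneg _ h1), zero_mul]

/-- **Dirichlet's integral** over a simplex, with integer exponents. -/
theorem integral_cornerSimplex (a₀ : ℕ) (a : Fin n → ℕ) :
    ∫ t in cornerSimplex n, (1 - ∑ i, t i) ^ a₀ * ∏ i, t i ^ a i =
      a₀.factorial * (∏ i, ((a i).factorial : ℝ)) / ((n + (a₀ + ∑ i, a i)).factorial : ℝ) := by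
  set M := ∫ t in cornerSimplex n, (1 - ∑ i, t i) ^ a₀ * ∏ i, t i ^ a i with hM
  let K : (Fin n → ℝ) × ℝ → ℝ := fun p =>
    (∏ i, gammaWeight (a i) (p.1 i)) * gammaWeight a₀ (p.2 - ∑ i, p.1 i)
  have hK0 : ∀ p, 0 ≤ K p := fun p =>
    mul_nonneg (prod_nonneg fun i _ => gammaWeight_nonneg _ _) (gammaWeight_nonneg _ _)
  have hKm : Measurable K := by
    refine Measurable.mul ?_ ?_
    · exact Finset.measurable_prod _ fun i _ => (measurable_gammaWeight _).comp (by fun_prop)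
    · exact (measurable_gammaWeight _).comp (by fun_prop)
  have hinner : ∀ t, ∫ u, K (t, u) = (∏ i, gammaWeight (a i) (t i)) * a₀.factorial := by
    intro t
    simp only [K]
    rw [integral_const_mul, integral_sub_right_eq_self (gammaWeight a₀), integral_gammaWeight]
  have hprod : Integrable fun t : Fin n → ℝ => ∏ i, gammaWeight (a i) (t i) :=
    Integrable.fintype_prod fun i => integrable_gammaWeight (a i)
  have hKi : Integrable K (volume.prod volume) := by
    refine (integrable_prod_iff hKm.aestronglyMeasurable).2 ⟨.of_forall fun t => ?_, ?_⟩
    · exact ((integrable_gammaWeight a₀).comp_sub_right (∑ i, t i)).const_mul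
        (∏ i, gammaWeight (a i) (t i))
    · simp only [Real.norm_of_nonneg (hK0 _), hinner]
      exact hprod.mul_const _
  have hleft : ∫ t, ∫ u, K (t, u) = (∏ i, ((a i).factorial : ℝ)) * a₀.factorial := by
    simp only [hinner]
    rw [integral_mul_const, integral_fintype_prod_volume_eq_prod fun i => gammaWeight (a i)]
    simp only [integral_gammaWeight]
  have hpos : ∀ u ∈ Set.Ioi (0 : ℝ), ∫ t, K (t, u) =
      u ^ (n + (a₀ + ∑ i, a i)) * Real.exp (-u) * M := by
    intro u hu
    rw [Set.mem_Ioi] at hu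
    have hscale := Measure.integral_comp_smul_of_nonneg (volume : Measure (Fin n → ℝ))
      (fun t => K (t, u)) u (hR := hu.le)
    have : ∀ t, K (u • t, u) = u ^ (a₀ + ∑ i, a i) * Real.exp (-u) *
        (cornerSimplex n).indicator (fun t => (1 - ∑ i, t i) ^ a₀ * ∏ i, t i ^ a i) t :=
      prod_gammaWeight_mul_gammaWeight_smul a₀ a hu
    simp only [this] at hscale
    rw [integral_const_mul, integral_indicator (isClosed_cornerSimplex n).measurableSet, ← hM,
      Module.finrank_fintype_fun_eq_card, Fintype.card_fin, smul_eq_mul] at hscale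
    rw [pow_add, mul_assoc (u ^ n), mul_assoc (u ^ n), hscale]
    field_simp
  have hneg : ∀ u ∈ Set.Iio (0 : ℝ), ∫ t, K (t, u) = 0 := by
    intro u hu
    have : ∀ t, K (t, u) = 0 := by
      intro t
      by_cases h : ∀ i, 0 ≤ t i
      · have h1 : ¬ 0 ≤ u - ∑ i, t i := by
          have := sum_nonneg fun i (_ : i ∈ univ) => h i
          have : u < 0 := hu
          linarith
        simp only [K]
        rw [gammaWeight_of_not_nonneg a₀ h1, mul_zero]
      · push Not at h
        obtain ⟨i, hi⟩ := h
        simp only [K]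
        rw [prod_eq_zero (mem_univ i) (gammaWeight_of_not_nonneg _ hi.not_ge), zero_mul]
    simp [this]
  have hright : ∫ u, ∫ t, K (t, u) = ((n + (a₀ + ∑ i, a i)).factorial : ℝ) * M := by
    rw [← setIntegral_pow_mul_exp_neg, ← integral_mul_const,
      ← integral_indicator measurableSet_Ioi]
    refine integral_congr_ae ?_
    filter_upwards [compl_mem_ae_iff.2 (measure_singleton (0 : ℝ))] with u hu
    rcases lt_or_gt_of_ne hu with h | h
    · rw [hneg u h, Set.indicator_of_notMem (Set.notMem_Ioi.2 h.le)]
    · rw [hpos u h, Set.indicator_of_mem (Set.mem_Ioi.2 h)]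
  have hswap := integral_integral_swap (f := fun t u => K (t, u)) hKi
  rw [hleft, hright] at hswap
  rw [eq_div_iff (by positivity), mul_comm, ← hswap, mul_comm]

end Dirichlet

section Parametrization

variable {n : ℕ} {E : Type*} [NormedAddCommGroup E] [InnerProductSpace ℝ E]

theorem exists_comap_hausdorffMeasure_eq_smul [MeasurableSpace E] [BorelSpace E]
    (L : (Fin n → ℝ) →ₗ[ℝ] E) (hL : Function.Injective L) (p : E) :
    ∃ c : NNReal, (μH[(n : ℝ)] : Measure E).comap (fun t => p + L t) = c • volume := by
  have hcl : Topology.IsClosedEmbedding (fun t => p + L t) :=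
    (Homeomorph.addLeft p).isClosedEmbedding.comp
      (LinearMap.isClosedEmbedding_of_injective (LinearMap.ker_eq_bot.2 hL))
  have hemb := hcl.measurableEmbedding
  set ν := (μH[(n : ℝ)] : Measure E).comap (fun t => p + L t) with hν
  obtain ⟨K, hK⟩ : ∃ K, LipschitzWith K (fun t => p + L t) :=
    ⟨_, (IsometryEquiv.addLeft p).isometry.lipschitz.comp
      (LinearMap.toContinuousLinearMap L).lipschitz⟩
  have hfin : IsFiniteMeasureOnCompacts ν := by
    refine ⟨fun s hs => ?_⟩
    rw [hν, hemb.comap_apply]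
    refine (hK.hausdorffMeasure_image_le (Nat.cast_nonneg n) s).trans_lt ?_
    have hvol : (μH[(n : ℝ)] : Measure (Fin n → ℝ)) = volume := by
      simpa using hausdorffMeasure_pi_real (ι := Fin n)
    rw [hvol]
    exact ENNReal.mul_lt_top (ENNReal.rpow_lt_top_of_nonneg (Nat.cast_nonneg n)
      ENNReal.coe_ne_top) hs.measure_lt_top
  have hinv : ν.IsAddLeftInvariant := by
    refine ⟨fun g => Measure.ext fun s hs => ?_⟩
    rw [Measure.map_apply (measurable_const_add g) hs, hν, hemb.comap_apply, hemb.comap_apply]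
    have : (fun t => p + L t) '' s =
        (IsometryEquiv.addLeft (L g)) '' ((fun t => p + L t) '' ((fun t => g + t) ⁻¹' s)) := by
      rw [Set.image_image]
      ext x
      constructor
      · rintro ⟨t, ht, rfl⟩
        refine ⟨t - g, by simpa using ht, ?_⟩
        simp only [IsometryEquiv.addLeft_apply, map_sub]
        abel
      · rintro ⟨t, ht, rfl⟩
        refine ⟨g + t, ht, ?_⟩
        simp only [IsometryEquiv.addLeft_apply, map_add]
        abel
    rw [this, IsometryEquiv.hausdorffMeasure_image]
  exact ⟨_, Measure.isAddLeftInvariant_eq_smul ν volume⟩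

/-- The barycentric coordinates on `cornerSimplex n`. -/
def barycentric (t : Fin n → ℝ) : Fin (n + 1) → ℝ :=
  Fin.cons (1 - ∑ i, t i) t

theorem sum_barycentric (t : Fin n → ℝ) : ∑ j, barycentric t j = 1 := by
  simp [barycentric, Fin.sum_univ_succ]

theorem sum_barycentric_smul (y : Fin (n + 1) → E) (t : Fin n → ℝ) :
    ∑ j, barycentric t j • y j =
      y 0 + Fintype.linearCombination ℝ (fun i : Fin n => y i.succ - y 0) t := by
  simp only [barycentric, Fin.sum_univ_succ, Fin.cons_zero, Fin.cons_succ,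
    Fintype.linearCombination_apply, smul_sub, sum_sub_distrib, sub_smul, one_smul, sum_smul]
  abel

theorem image_cornerSimplex (y : Fin (n + 1) → E) :
    (fun t => ∑ j, barycentric t j • y j) '' cornerSimplex n = convexHull ℝ (Set.range y) := by
  refine Set.Subset.antisymm ?_ (convexHull_min ?_ ?_)
  · rintro _ ⟨t, ht, rfl⟩
    refine (convex_convexHull ℝ _).sum_mem (fun j _ => ?_) (sum_barycentric t)
      fun j _ => subset_convexHull ℝ _ ⟨j, rfl⟩
    refine Fin.cases ?_ (fun i => ?_) j
    · simpa [barycentric] using ht.2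
    · simpa [barycentric] using ht.1 i
  · rintro _ ⟨j, rfl⟩
    refine Fin.cases ⟨0, ?_, ?_⟩ (fun i => ⟨Pi.single i 1, ?_, ?_⟩) j
    · simp [cornerSimplex]
    · simp [sum_barycentric_smul]
    · exact ⟨fun k => by by_cases h : k = i <;> simp [h], by simp⟩
    · simp [sum_barycentric_smul, Fintype.linearCombination_apply_single]
  · simp only [sum_barycentric_smul]
    rw [← Set.image_image (fun v => y 0 + v)]
    refine Convex.translate ?_ (y 0)
    refine Convex.linear_image ?_ _
    intro s hs t ht a b ha hb hab
    refine ⟨fun i => add_nonneg (mul_nonneg ha (hs.1 i)) (mul_nonneg hb (ht.1 i)), ?_⟩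
    simp only [Pi.add_apply, Pi.smul_apply, smul_eq_mul, sum_add_distrib, ← mul_sum]
    nlinarith [hs.2, ht.2]

theorem exists_setIntegral_convexHull_eq [MeasurableSpace E] [BorelSpace E]
    {y : Fin (n + 1) → E} (hy : AffineIndependent ℝ y) :
    ∃ c : ℝ, ∀ g : E → ℝ, ∫ p in convexHull ℝ (Set.range y), g p ∂μH[(n : ℝ)] =
      c * ∫ t in cornerSimplex n, g (∑ j, barycentric t j • y j) := by
  set L := Fintype.linearCombination ℝ (fun i : Fin n => y i.succ - y 0) with hLdef
  have hli : LinearIndependent ℝ (fun i : Fin n => y i.succ - y 0) := by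
    have := (affineIndependent_iff_linearIndependent_vsub ℝ y 0).1 hy
    exact this.comp (fun i : Fin n => ⟨i.succ, Fin.succ_ne_zero i⟩)
      fun i j h => Fin.succ_injective _ (Subtype.ext_iff.1 h)
  have hL : Function.Injective L := hli.fintypeLinearCombination_injective
  obtain ⟨c, hc⟩ := exists_comap_hausdorffMeasure_eq_smul L hL (y 0)
  have hemb : MeasurableEmbedding (fun t => y 0 + L t) :=
    ((Homeomorph.addLeft (y 0)).isClosedEmbedding.comp
      (LinearMap.isClosedEmbedding_of_injective (LinearMap.ker_eq_bot.2 hL))).measurableEmbedding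
  refine ⟨c, fun g => ?_⟩
  have hsub : convexHull ℝ (Set.range y) ⊆ Set.range (fun t => y 0 + L t) := by
    rw [← image_cornerSimplex]
    simp only [sum_barycentric_smul]
    exact Set.image_subset_range _ _
  have hpre : (fun t => y 0 + L t) ⁻¹' convexHull ℝ (Set.range y) = cornerSimplex n := by
    rw [← image_cornerSimplex]
    simp only [sum_barycentric_smul]
    exact Set.preimage_image_eq _ hemb.injective
  have hrestr : (μH[(n : ℝ)] : Measure E).restrict (convexHull ℝ (Set.range y)) =
      (((μH[(n : ℝ)] : Measure E).comap (fun t => y 0 + L t)).map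
        (fun t => y 0 + L t)).restrict (convexHull ℝ (Set.range y)) := by
    rw [hemb.map_comap, Measure.restrict_restrict_of_subset hsub]
  rw [hrestr, hemb.setIntegral_map, hpre, hc]
  simp only [sum_barycentric_smul]
  rw [Measure.restrict_smul, integral_smul_nnreal_measure]
  rfl

theorem integral_prod_barycentric {r : ℕ} (φ : Fin r → Fin (n + 1)) :
    ∫ t in cornerSimplex n, ∏ l, barycentric t (φ l) =
      fiberFactorial φ univ / ((n + r).factorial : ℝ) := by
  set b : Fin (n + 1) → ℕ := fun j => (univ.filter fun l => φ l = j).card with hb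
  have hsum : b 0 + ∑ i : Fin n, b i.succ = r := by
    rw [← Fin.sum_univ_succ, hb, ← card_eq_sum_card_fiberwise (fun l _ => mem_univ (φ l)),
      card_univ, Fintype.card_fin]
  have h := integral_cornerSimplex (b 0) fun i => b i.succ
  rw [hsum] at h
  have hprod : ∀ t : Fin n → ℝ, ∏ l, barycentric t (φ l) =
      (1 - ∑ i, t i) ^ b 0 * ∏ i : Fin n, t i ^ b i.succ := by
    intro t
    rw [← prod_fiberwise' univ φ (barycentric t), Fin.prod_univ_succ]
    simp only [prod_const]
    rfl
  simp only [hprod, h, fiberFactorial, Fin.prod_univ_succ]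
  rfl

theorem setIntegral_prod_coordinates {r : ℕ} {y : Fin (n + 1) → EuclideanSpace ℝ (Fin (n + 1))}
    (hy : AffineIndependent ℝ y) (I : Fin r → Fin (n + 1)) :
    ∫ p in convexHull ℝ (Set.range y), ∏ l, p (I l) ∂μH[(n : ℝ)] =
      (n.factorial : ℝ) / ((r + n).factorial) *
        (μH[(n : ℝ)] (convexHull ℝ (Set.range y))).toReal *
          ∑ φ : Fin r → Fin (n + 1), fiberFactorial φ univ * ∏ l, y (φ l) (I l) := by
  obtain ⟨c, hc⟩ := exists_setIntegral_convexHull_eq hy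
  have hvol : (μH[(n : ℝ)] (convexHull ℝ (Set.range y))).toReal = c / n.factorial := by
    have h1 := hc fun _ => 1
    have h2 := integral_cornerSimplex (n := n) 0 0
    simp only [pow_zero, Pi.zero_apply, prod_const_one, mul_one, Nat.factorial_zero,
      Nat.cast_one, sum_const_zero, add_zero] at h2
    rw [h2, setIntegral_const, smul_eq_mul, mul_one] at h1
    rw [← measureReal_def, h1]
    ring
  have hexp : ∀ t : Fin n → ℝ, ∏ l, (∑ j, barycentric t j • y j) (I l) =
      ∑ φ : Fin r → Fin (n + 1), (∏ l, barycentric t (φ l)) * ∏ l, y (φ l) (I l) := by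
    intro t
    have : ∀ l, (∑ j, barycentric t j • y j) (I l) = ∑ j, barycentric t j * y j (I l) := by
      intro l
      simp
    simp only [this, Fintype.prod_sum, prod_mul_distrib]
  have hint : ∀ φ : Fin r → Fin (n + 1), IntegrableOn
      (fun t => (∏ l, barycentric t (φ l)) * ∏ l, y (φ l) (I l)) (cornerSimplex n) := by
    intro φ
    refine ContinuousOn.integrableOn_compact (isCompact_cornerSimplex n)
      (Continuous.continuousOn ?_)
    have : ∀ j, Continuous fun t : Fin n → ℝ => barycentric t j := by
      intro j
      refine Fin.cases ?_ (fun i => ?_) j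
      · simp only [barycentric, Fin.cons_zero]
        fun_prop
      · simp only [barycentric, Fin.cons_succ]
        fun_prop
    fun_prop
  rw [hc]
  simp only [hexp]
  rw [integral_finsetSum _ fun φ _ => hint φ, hvol]
  simp only [integral_mul_const, integral_prod_barycentric, mul_sum]
  refine sum_congr rfl fun φ _ => ?_
  have : (n.factorial : ℝ) ≠ 0 := by positivity
  rw [add_comm n r]
  field_simp

end Parametrization

end SurfaceTensor

/-- Let `P = conv{x_1,…,x_m} ⊆ ℝ^d` be a full-dimensional simplicial
polytope — each facet, described by its vertex index set `F i` of size `d` (affinely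
independent vertices), with outer unit normal `u i` and supporting level `c i`, the
facets covering the boundary of `P`. Fix `r ≥ 1` and `s ≥ 0`. For every weakly
increasing tuple `I = (i_1 ≤ ⋯ ≤ i_r)` with entries in `{1,…,d}` and multiplicities
`a(I)_j = #{l : i_l = j}`, and every component `w` of the `s`-fold tensor power,
`∑_{F∈ℱ_{d−1}(P)} (∫_F x_1^{a_1}⋯x_d^{a_d} dH^{d−1}) u_F^{⊗s}
  = ((d−1)!/(r+d−1)!) ∑_{F∈ℱ_{d−1}(P)} V_{d−1}(F) u_F^{⊗s}
      [∑_{k=1}^r (−1)^{k+r} k! ∑_π ∏_{B∈π} e^{I_B}(F)]`,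
the inner sum over partitions `π` of `{1,…,r}` into `k` nonempty blocks of size at most
`d`; this is the componentwise form of the formula for the rank `r+s` Minkowski surface
tensor `Φ_{d−1}^{r,s}(P)`. -/
theorem stmt_13 (d m fc r s : ℕ) (hr : 1 ≤ r) (x : Fin m → EuclideanSpace ℝ (Fin d))
    (hfull : (interior (convexHull ℝ (Set.range x))).Nonempty)
    (F : Fin fc → Finset (Fin m)) (u : Fin fc → EuclideanSpace ℝ (Fin d)) (c : Fin fc → ℝ)
    (hcard : ∀ i, (F i).card = d)
    (hindep : ∀ i, AffineIndependent ℝ (fun k : {k // k ∈ F i} => x k.1))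
    (hnorm : ∀ i, ‖u i‖ = 1)
    (hmem : ∀ i, ∀ k ∈ F i, ∑ j, x k j * u i j = c i)
    (hlt : ∀ i, ∀ k ∉ F i, ∑ j, x k j * u i j < c i)
    (hbound : ∀ p ∈ frontier (convexHull ℝ (Set.range x)),
      ∃ i, p ∈ convexHull ℝ (x '' ↑(F i)))
    (hinjF : Function.Injective F) :
    ∀ I : Fin r → Fin d, Monotone I → ∀ w : Fin s → Fin d,
      ∑ i, (∫ p in convexHull ℝ (x '' ↑(F i)),
            ∏ jd, p jd ^ (Finset.univ.filter (fun l => I l = jd)).card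
          ∂(μH[(d : ℝ) - 1])) * ∏ q, u i (w q)
        = (Nat.factorial (d - 1) : ℝ) / (Nat.factorial (r + d - 1)) *
            ∑ i, (μH[(d : ℝ) - 1] (convexHull ℝ (x '' ↑(F i)))).toReal *
              (∏ q, u i (w q)) *
              ∑ k ∈ Finset.Icc 1 r, (-1 : ℝ) ^ (k + r) * Nat.factorial k *
                ∑ π ∈ partsKd r k d, ∏ B ∈ π,
                  eSym d (fun jv => x ↑((F i).orderIsoOfFin (hcard i) jv)) I B := by
  intro I _ w
  obtain ⟨n, rfl⟩ : ∃ n, d = n + 1 := Nat.exists_eq_succ_of_ne_zero (I ⟨0, hr⟩).pos.ne'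
  have hdim : ((n + 1 : ℕ) : ℝ) - 1 = n := by
    push_cast
    ring
  rw [hdim, mul_sum]
  refine sum_congr rfl fun i _ => ?_
  set y : Fin (n + 1) → EuclideanSpace ℝ (Fin (n + 1)) :=
    fun jv => x ↑((F i).orderIsoOfFin (hcard i) jv) with hy
  have hrange : x '' ↑(F i) = Set.range y := by
    ext p
    constructor
    · rintro ⟨k, hk, rfl⟩
      exact ⟨((F i).orderIsoOfFin (hcard i)).symm ⟨k, hk⟩, by
        rw [hy]
        simp only [OrderIso.apply_symm_apply]⟩
    · rintro ⟨jv, rfl⟩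
      exact ⟨_, ((F i).orderIsoOfFin (hcard i) jv).2, rfl⟩
  have hyind : AffineIndependent ℝ y :=
    (hindep i).comp_embedding ((F i).orderIsoOfFin (hcard i)).toEquiv.toEmbedding
  have hprod : ∀ p : EuclideanSpace ℝ (Fin (n + 1)),
      ∏ jd, p jd ^ (univ.filter fun l => I l = jd).card = ∏ l, p (I l) := by
    intro p
    rw [← prod_fiberwise' univ I fun jd => p jd]
    simp only [prod_const]
  simp only [hprod, hrange]
  rw [SurfaceTensor.setIntegral_prod_coordinates hyind I,
    SurfaceTensor.alternating_sum_partsKd_eq hr y I 0, Nat.add_sub_cancel, ← add_assoc,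
    Nat.add_sub_cancel]
  ring
end
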